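/- arXiv:2601.15218 — 5 statements merged into one kernel-verified Lean document; each statement's English description precedes it below -/
import Mathlib

section
/- Let (X,d) be a Polish space, N ≥ 2, ρ a Borel probability measure on X, and α > 0. If κ_ρ(α) := sup_{x∈X} ρ(B̄(x,α)) ≤ 1/N, then there exists an N-coupling λ of ρ (a probability measure on X^N all of whose N coordinate marginals equal ρ) such that λ(𝓑_α) = 0, where 𝓑_α := {(x_1,…,x_N) ∈ X^N : min_{i≠j} d(x_i,x_j) < α}. -/
open MeasureTheory Metric ENNReal

lemma greedy {V : Type*} [Fintype V] (R : V → V → Prop) (hR : ∀ a b, R a b → R b a)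
    (p : V → ℝ) (hp : ∀ v, 0 ≤ p v) (c : ℝ) (hc : 0 < c)
    [∀ v, DecidablePred (R v)]
    (hd : ∀ v, ∑ u with ¬ R v u, p u ≤ c) (k : ℕ) :
    ∀ (S : Finset V) (w : V → ℝ), (∀ v ∈ S, 0 ≤ w v) → (k : ℝ) * c ≤ ∑ v ∈ S, p v →
    ∃ t : Fin k → V, (∀ i, t i ∈ S) ∧ (∀ i j, i ≠ j → R (t i) (t j)) ∧
      c * ∑ i, w (t i) ≤ ∑ v ∈ S, p v * w v := by
  induction k with
  | zero =>
    intro S w hw _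
    refine ⟨Fin.elim0, fun i => i.elim0, fun i => i.elim0, ?_⟩
    simp
    exact Finset.sum_nonneg fun v hv => mul_nonneg (hp v) (hw v hv)
  | succ k ih =>
    intro S w hw hS
    push_cast at hS
    have hne : S.Nonempty := by
      rw [Finset.nonempty_iff_ne_empty]
      rintro rfl
      simp at hS
      nlinarith [mul_nonneg (Nat.cast_nonneg (α := ℝ) k) hc.le]
    obtain ⟨v, hvS, hv⟩ := S.exists_min_image w hne
    have hsplit := Finset.sum_filter_add_sum_filter_not S (R v) p
    have hle : ∑ u ∈ S with ¬ R v u, p u ≤ c := by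
      refine le_trans (Finset.sum_le_sum_of_subset_of_nonneg ?_ fun u _ _ => hp u) (hd v)
      exact Finset.filter_subset_filter _ (Finset.subset_univ S)
    obtain ⟨t, htS, htR, ht⟩ := ih (S.filter (R v)) (fun u => w u - w v)
      (fun u hu => sub_nonneg.2 (hv u (Finset.mem_filter.1 hu).1)) (by linarith)
    refine ⟨Fin.cons v t, ?_, ?_, ?_⟩
    · intro i
      refine Fin.cases ?_ ?_ i
      · simpa using hvS
      · intro j
        simpa using (Finset.mem_filter.1 (htS j)).1
    · intro i j
      refine Fin.cases ?_ ?_ i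
      · refine Fin.cases ?_ ?_ j
        · simp
        · intro j _
          simpa using (Finset.mem_filter.1 (htS j)).2
      · intro i
        refine Fin.cases ?_ ?_ j
        · intro _
          simpa using hR _ _ (Finset.mem_filter.1 (htS i)).2
        · intro j hij
          simpa using htR i j (by simpa using hij)
    · have h1 : ∑ u ∈ S.filter (R v), p u * (w u - w v) ≤ ∑ u ∈ S, p u * (w u - w v) := by
        refine Finset.sum_le_sum_of_subset_of_nonneg (Finset.filter_subset _ _) ?_
        intro u hu _
        exact mul_nonneg (hp u) (sub_nonneg.2 (hv u hu))
      have h2 : ∑ u ∈ S, p u * (w u - w v) = ∑ u ∈ S, p u * w u - (∑ u ∈ S, p u) * w v := by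
        simp only [mul_sub, Finset.sum_sub_distrib, Finset.sum_mul]
      rw [Fin.sum_univ_succ]
      simp only [Fin.cons_zero, Fin.cons_succ]
      simp only [Finset.sum_sub_distrib, Finset.sum_const, Finset.card_univ, Fintype.card_fin,
        nsmul_eq_mul] at ht
      have h3 := mul_le_mul_of_nonneg_right hS (hw v hvS)
      nlinarith

lemma finite_tiling {V : Type*} [Fintype V] [DecidableEq V] (N : ℕ) (hN : 2 ≤ N)
    (R : V → V → Prop) (hR : ∀ a b, R a b → R b a)
    (p : V → ℝ) (hp : ∀ v, 0 ≤ p v) (hp1 : ∑ v, p v = 1)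
    [∀ v, DecidablePred (R v)]
    (hd : ∀ v, ∑ u with ¬ R v u, p u ≤ (N : ℝ)⁻¹) :
    ∃ q : (Fin N → V) → ℝ, (∀ t, 0 ≤ q t) ∧ (∀ t, q t ≠ 0 → ∀ i j, i ≠ j → R (t i) (t j)) ∧
      ∀ i v, ∑ t, (if t i = v then q t else 0) = p v := by
  classical
  have hN0 : (0 : ℝ) < N := by positivity
  let T := {t : Fin N → V // ∀ i j, i ≠ j → R (t i) (t j)}
  let L : (T → ℝ) →ₗ[ℝ] (V → ℝ) :=
    { toFun := fun q v => ∑ t : T, q t * ((N : ℝ)⁻¹ * ∑ i, if t.1 i = v then 1 else 0)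
      map_add' := by intro a b; ext v; simp [add_mul, Finset.sum_add_distrib]
      map_smul' := by intro a b; ext v; simp [mul_assoc, Finset.mul_sum] }
  have hmem : p ∈ L '' stdSimplex ℝ T := by
    by_contra hcon
    have hconv : Convex ℝ (L '' stdSimplex ℝ T) := (convex_stdSimplex ℝ T).linear_image L
    have hcl : IsClosed (L '' stdSimplex ℝ T) :=
      ((isCompact_stdSimplex ℝ T).image L.continuous_of_finiteDimensional).isClosed
    obtain ⟨f, u, hfu, hf⟩ := geometric_hahn_banach_point_closed hconv hcl hcon
    let w : V → ℝ := fun v => f (Pi.single v 1)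
    have hfw : ∀ x : V → ℝ, f x = ∑ v, x v * w v := by
      intro x
      conv_lhs => rw [pi_eq_sum_univ' x]
      rw [map_sum]
      refine Finset.sum_congr rfl fun v _ => ?_
      rw [map_smul, smul_eq_mul]
    let m : ℝ := ∑ v, |w v|
    obtain ⟨t, -, htR, ht⟩ := greedy R hR p hp (N : ℝ)⁻¹ (by positivity) hd N Finset.univ
      (fun v => w v + m)
      (fun v _ => by
        have := Finset.single_le_sum (f := fun v => |w v|) (fun i _ => abs_nonneg _)
          (Finset.mem_univ v)
        have h2 := neg_abs_le (w v)
        simp only [m]; linarith)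
      (by rw [hp1, mul_inv_cancel₀ hN0.ne'])
    have hb := hf _ ⟨Pi.single (⟨t, htR⟩ : T) 1, single_mem_stdSimplex ℝ _, rfl⟩
    have hL : L (Pi.single (⟨t, htR⟩ : T) 1) =
        fun v => (N : ℝ)⁻¹ * ∑ i, if t i = v then 1 else 0 := by
      ext v
      simp only [L, LinearMap.coe_mk, AddHom.coe_mk]
      rw [Finset.sum_eq_single (⟨t, htR⟩ : T)]
      · simp
      · intro b _ hb
        simp [Pi.single_eq_of_ne hb]
      · simp
    rw [hL, hfw] at hb
    rw [hfw] at hfu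
    have hs : ∑ v, ((N : ℝ)⁻¹ * ∑ i, if t i = v then 1 else 0) * w v
        = (N : ℝ)⁻¹ * ∑ i, w (t i) := by
      simp only [mul_assoc, ← Finset.mul_sum, Finset.sum_mul]
      rw [Finset.sum_comm]
      simp
    rw [hs] at hb
    simp only [Finset.sum_add_distrib, mul_add, Finset.sum_const, Finset.card_univ,
      Fintype.card_fin, nsmul_eq_mul, ← Finset.sum_mul, hp1] at ht
    rw [← mul_assoc, inv_mul_cancel₀ hN0.ne'] at ht
    linarith
  obtain ⟨q, ⟨hq0, hq1⟩, hqp⟩ := hmem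
  let q0 : (Fin N → V) → ℝ := fun t => if h : ∀ i j, i ≠ j → R (t i) (t j) then q ⟨t, h⟩ else 0
  have hq00 : ∀ t, 0 ≤ q0 t := by
    intro t; simp only [q0]; split_ifs
    · exact hq0 _
    · exact le_rfl
  have hq0R : ∀ t, q0 t ≠ 0 → ∀ i j, i ≠ j → R (t i) (t j) := by
    intro t ht; by_contra h
    exact ht (by simp only [q0]; rw [dif_neg h])
  have hq0p : ∀ v, ∑ t, q0 t * ((N : ℝ)⁻¹ * ∑ i, if t i = v then 1 else 0) = p v := by
    intro v
    rw [← hqp]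
    simp only [L, LinearMap.coe_mk, AddHom.coe_mk]
    symm
    refine Fintype.sum_of_injective (Subtype.val : T → Fin N → V) Subtype.val_injective _ _ ?_ ?_
    · intro t ht
      have : q0 t = 0 := by
        simp only [q0]
        rw [dif_neg]
        intro h
        exact ht ⟨⟨t, h⟩, rfl⟩
      rw [this, zero_mul]
    · intro t
      have : q0 t.1 = q t := by
        simp only [q0]
        rw [dif_pos t.2]
      rw [this]
  have : NeZero N := ⟨by omega⟩
  refine ⟨fun t => (N : ℝ)⁻¹ * ∑ s : Fin N, q0 (fun i => t (i + s)), ?_, ?_, ?_⟩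
  · intro t
    exact mul_nonneg (by positivity) (Finset.sum_nonneg fun s _ => hq00 _)
  · intro t ht i j hij
    have : ∑ s : Fin N, q0 (fun i => t (i + s)) ≠ 0 := right_ne_zero_of_mul ht
    obtain ⟨s, -, hs⟩ := Finset.exists_ne_zero_of_sum_ne_zero this
    have := hq0R _ hs (i - s) (j - s) (by simpa using hij)
    simpa using this
  · intro i v
    rw [← hq0p v]
    have h1 : ∀ s : Fin N, ∑ t : Fin N → V, (if t i = v then q0 (fun i => t (i + s)) else 0)
        = ∑ t : Fin N → V, (if t (i - s) = v then q0 t else 0) := by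
      intro s
      rw [← Equiv.sum_comp (Equiv.arrowCongr (Equiv.subRight s) (Equiv.refl V))
        (fun t => if t (i - s) = v then q0 t else 0)]
      refine Finset.sum_congr rfl fun t _ => ?_
      have : (Equiv.arrowCongr (Equiv.subRight s) (Equiv.refl V)) t = fun i => t (i + s) := by
        ext j; simp [Equiv.arrowCongr]
      rw [this]; simp
    calc ∑ t : Fin N → V, (if t i = v then (N : ℝ)⁻¹ * ∑ s, q0 (fun i => t (i + s)) else 0)
        = (N : ℝ)⁻¹ * ∑ s : Fin N, ∑ t : Fin N → V,
            (if t i = v then q0 (fun i => t (i + s)) else 0) := by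
          rw [Finset.sum_comm, Finset.mul_sum]
          refine Finset.sum_congr rfl fun t _ => ?_
          split_ifs <;> simp
      _ = (N : ℝ)⁻¹ * ∑ s : Fin N, ∑ t : Fin N → V, (if t (i - s) = v then q0 t else 0) := by
          simp only [h1]
      _ = _ := by
          rw [Finset.sum_comm, Finset.mul_sum]
          refine Finset.sum_congr rfl fun t _ => ?_
          rw [← Equiv.sum_comp (Equiv.subLeft i) (fun j => if t j = v then (1:ℝ) else 0)]
          simp only [Equiv.subLeft_apply, Finset.mul_sum]
          refine Finset.sum_congr rfl fun s _ => ?_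
          split_ifs <;> ring

lemma approx_coupling {X : Type*} [MetricSpace X] [PolishSpace X] [MeasurableSpace X] [BorelSpace X]
    (N : ℕ) (hN : 2 ≤ N)
    (ρ : Measure X) [IsProbabilityMeasure ρ]
    (α : ℝ)
    (hκ : (⨆ x : X, ρ (closedBall x α)) ≤ (N : ℝ≥0∞)⁻¹) (ε : ℝ) (hε : 0 < ε) 
    (δ : ℝ≥0∞) (hδ : 0 < δ) :
    ∃ lam : Measure (Fin N → X), IsProbabilityMeasure lam ∧
      (∀ i : Fin N, lam.map (fun x => x i) = ρ) ∧
      lam {x : Fin N → X | ∃ i j : Fin N, i ≠ j ∧ dist (x i) (x j) < α - ε} ≤ δ := by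
  classical
  have hXne : Nonempty X := nonempty_of_isProbabilityMeasure ρ
  -- countable partition
  let D := TopologicalSpace.denseSeq X
  have hD : ∀ x : X, ∃ n, dist x (D n) < ε / 4 := fun x => by
    obtain ⟨n, hn⟩ :=
      (TopologicalSpace.denseRange_denseSeq X).exists_dist_lt x (show 0 < ε / 4 by linarith)
    exact ⟨n, hn⟩
  let g : X → ℕ := fun x => Nat.find (hD x)
  have hg : Measurable g := measurable_find hD fun k =>
    (isOpen_lt (by fun_prop) (by fun_prop)).measurableSet
  have hgd : ∀ x, dist x (D (g x)) < ε / 4 := fun x => Nat.find_spec (hD x)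
  have htail : ∃ n, ρ {x | n ≤ g x} < δ / N := by
    have h1 : Filter.Tendsto (fun n => ρ {x | n ≤ g x}) Filter.atTop
        (nhds (ρ (⋂ n, {x | n ≤ g x}))) := by
      refine tendsto_measure_iInter_atTop ?_ ?_ ⟨0, measure_ne_top _ _⟩
      · intro n
        exact (measurableSet_le measurable_const hg).nullMeasurableSet
      · intro a b hab x hx
        exact le_trans hab hx
    have h2 : (⋂ n, {x | n ≤ g x}) = ∅ := by
      ext x
      simp only [Set.mem_iInter, Set.mem_ofPred_eq, Set.mem_empty_iff_false, iff_false, not_forall]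
      exact ⟨g x + 1, by omega⟩
    rw [h2, measure_empty] at h1
    exact (h1.eventually_lt_const (ENNReal.div_pos hδ.ne' (by simp))).exists
  obtain ⟨n, hn⟩ := htail
  let f : X → Fin (n + 1) := fun x => ⟨min (g x) n, by omega⟩
  have hf : Measurable f :=
    (measurable_of_countable (fun k : ℕ => (⟨min k n, by omega⟩ : Fin (n+1)))).comp hg
  have hflast : ∀ x, f x = Fin.last n ↔ n ≤ g x := by
    intro x; simp [f, Fin.ext_iff]
  have hfd : ∀ x y, f x = f y → f x ≠ Fin.last n → dist x y < ε / 2 := by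
    intro x y hxy hx
    have hy : f y ≠ Fin.last n := hxy ▸ hx
    rw [Ne, hflast] at hx hy
    simp only [f, Fin.ext_iff] at hxy
    have : g x = g y := by omega
    have h1 := hgd x
    have h2 := hgd y
    rw [← this] at h2
    have := dist_triangle_right x y (D (g x))
    linarith
  let R : Fin (n+1) → Fin (n+1) → Prop := fun a b => a = Fin.last n ∨ b = Fin.last n ∨
    ∀ x y, f x = a → f y = b → α - ε ≤ dist x y
  have hR : ∀ a b, R a b → R b a := by
    rintro a b (h | h | h)
    · exact Or.inr (Or.inl h)
    · exact Or.inl h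
    · exact Or.inr (Or.inr fun x y hx hy => dist_comm x y ▸ h y x hy hx)
  let p : Fin (n+1) → ℝ := fun a => ρ.real (f ⁻¹' {a})
  have hsum : ∀ S : Finset (Fin (n+1)), ∑ a ∈ S, p a = ρ.real (f ⁻¹' S) := by
    intro S
    exact sum_measureReal_preimage_singleton S fun a _ => hf (measurableSet_singleton a)
  have hp1 : ∑ a, p a = 1 := by rw [hsum]; simp
  have hd : ∀ a, ∑ b with ¬ R a b, p b ≤ (N : ℝ)⁻¹ := by
    intro a
    rw [hsum]
    have key : ∃ x, f ⁻¹' ((Finset.univ.filter fun b => ¬ R a b : Finset _) : Set (Fin (n+1))) ⊆ closedBall x α := by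
      by_cases ha : ∃ x, f x = a
      · obtain ⟨x, hx⟩ := ha
        refine ⟨x, fun y hy => ?_⟩
        simp only [Finset.coe_filter, Finset.mem_univ, true_and, Set.mem_preimage,
          Set.mem_ofPred_eq, R, not_or, not_forall, not_le] at hy
        obtain ⟨h1, h2, x', y', hx', hy', hxy⟩ := hy
        have e1 := hfd x' x (hx'.trans hx.symm) (hx' ▸ h1)
        have e2 := hfd y' y hy' (hy' ▸ h2)
        rw [mem_closedBall]
        have t1 := dist_triangle4 y y' x' x
        rw [dist_comm y y', dist_comm y' x'] at t1
        linarith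
      · refine ⟨hXne.some, fun y hy => ?_⟩
        simp only [Finset.coe_filter, Finset.mem_univ, true_and, Set.mem_preimage,
          Set.mem_ofPred_eq, R, not_or, not_forall, not_le] at hy
        obtain ⟨h1, h2, x', y', hx', hy', hxy⟩ := hy
        exact absurd ⟨x', hx'⟩ ha
    obtain ⟨x, hx⟩ := key
    have h1 : ρ (f ⁻¹' ((Finset.univ.filter fun b => ¬ R a b : Finset _) : Set (Fin (n+1)))) ≤ (N : ℝ≥0∞)⁻¹ :=
      (measure_mono hx).trans ((le_iSup (fun x => ρ (closedBall x α)) x).trans hκ)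
    have h2 := ENNReal.toReal_mono (by simp; omega) h1
    simpa [Measure.real] using h2
  obtain ⟨q, hq0, hqR, hqp⟩ := finite_tiling N hN R hR p (fun a => measureReal_nonneg) hp1 hd
  have hqpos : ∀ t, q t ≠ 0 → ∀ i, ρ (f ⁻¹' {t i}) ≠ 0 := by
    intro t ht i h0
    have h1 := hqp i (t i)
    have h2 : p (t i) = 0 := by simp [p, Measure.real, h0]
    rw [h2, Finset.sum_eq_zero_iff_of_nonneg] at h1
    · have := h1 t (Finset.mem_univ _)
      rw [if_pos rfl] at this
      exact ht this
    · intro s _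
      split_ifs
      · exact hq0 s
      · exact le_rfl
  let ν : Fin (n+1) → Measure X := fun a =>
    if ρ (f ⁻¹' {a}) = 0 then ρ else ProbabilityTheory.cond ρ (f ⁻¹' {a})
  have hν : ∀ a, IsProbabilityMeasure (ν a) := by
    intro a
    simp only [ν]
    split_ifs with h
    · infer_instance
    · exact ProbabilityTheory.cond_isProbabilityMeasure h
  have hνρ : ∑ a, ρ (f ⁻¹' {a}) • ν a = ρ := by
    conv_rhs => rw [← ProbabilityTheory.sum_meas_smul_cond_fiber hf ρ]
    refine Finset.sum_congr rfl fun a _ => ?_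
    simp only [ν]
    split_ifs with h
    · rw [h, zero_smul, zero_smul]
    · rfl
  let lam : Measure (Fin N → X) := ∑ t : Fin N → Fin (n+1),
    ENNReal.ofReal (q t) • Measure.pi (fun i => ν (t i))
  have hmarg : ∀ i : Fin N, lam.map (fun x => x i) = ρ := by
    intro i
    have h1 : lam.map (fun x => x i) =
        ∑ t : Fin N → Fin (n+1), ENNReal.ofReal (q t) • ν (t i) := by
      rw [← Measure.mapₗ_apply_of_measurable (measurable_pi_apply i)]
      simp only [lam, map_sum]
      refine Finset.sum_congr rfl fun t _ => ?_
      rw [Measure.mapₗ_apply_of_measurable (measurable_pi_apply i), Measure.map_smul]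
      congr 1
      exact (measurePreserving_eval (fun i => ν (t i)) i).map_eq
    rw [h1]
    conv_rhs => rw [← hνρ]
    have h2 : ∀ a, ρ (f ⁻¹' {a}) = ∑ t : Fin N → Fin (n+1),
        if t i = a then ENNReal.ofReal (q t) else 0 := by
      intro a
      have := congrArg ENNReal.ofReal (hqp i a)
      rw [ENNReal.ofReal_sum_of_nonneg] at this
      · simp only [p] at this
        rw [ofReal_measureReal] at this
        rw [← this]
        refine Finset.sum_congr rfl fun t _ => ?_
        split_ifs <;> simp
      · intro s _
        split_ifs
        · exact hq0 s
        · exact le_rfl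
    simp only [h2, Finset.sum_smul]
    rw [Finset.sum_comm]
    refine Finset.sum_congr rfl fun t _ => ?_
    simp [ite_smul]
  have hprob : IsProbabilityMeasure lam := by
    constructor
    have h := congrArg (fun m => m Set.univ) (hmarg ⟨0, by omega⟩)
    simp only [measure_univ] at h
    rw [Measure.map_apply (measurable_pi_apply _) MeasurableSet.univ] at h
    simpa using h
  refine ⟨lam, hprob, hmarg, ?_⟩
  -- bad set
  have hclique : lam {x | ¬ ∀ i j, i ≠ j → R (f (x i)) (f (x j))} = 0 := by
    simp only [lam, Measure.coe_finsetSum, Finset.sum_apply, Measure.coe_smul, Pi.smul_apply,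
      smul_eq_mul]
    refine Finset.sum_eq_zero fun t _ => ?_
    by_cases ht : q t = 0
    · simp [ht]
    · rw [mul_eq_zero]
      right
      have hae : ∀ i, ∀ᵐ x ∂(Measure.pi fun i => ν (t i)), f (x i) = t i := by
        intro i
        have h1 : ∀ᵐ y ∂(ν (t i)), f y = t i := by
          simp only [ν]
          rw [if_neg (hqpos t ht i)]
          exact ProbabilityTheory.ae_cond_mem (hf (measurableSet_singleton _))
        exact (measurePreserving_eval (fun i => ν (t i)) i).quasiMeasurePreserving.ae h1
      have hall := ae_all_iff.2 hae
      rw [← MeasureTheory.ae_iff]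
      filter_upwards [hall] with x hx i j hij
      rw [hx i, hx j]
      exact hqR t ht i j hij
  have hT : ∀ i : Fin N, lam {x | f (x i) = Fin.last n} ≤ δ / N := by
    intro i
    have h1 : {x : Fin N → X | f (x i) = Fin.last n} = (fun x => x i) ⁻¹' {y | n ≤ g y} := by
      ext x; simp [hflast]
    rw [h1, ← Measure.map_apply (measurable_pi_apply i) (measurableSet_le measurable_const hg),
      hmarg i]
    exact hn.le
  calc lam {x : Fin N → X | ∃ i j : Fin N, i ≠ j ∧ dist (x i) (x j) < α - ε}
      ≤ lam ({x | ¬ ∀ i j, i ≠ j → R (f (x i)) (f (x j))} ∪ ⋃ i, {x | f (x i) = Fin.last n}) := by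
        refine measure_mono ?_
        rintro x ⟨i, j, hij, hd⟩
        by_cases h : ∀ i j, i ≠ j → R (f (x i)) (f (x j))
        · right
          rw [Set.mem_iUnion]
          rcases h i j hij with h | h | h
          · exact ⟨i, h⟩
          · exact ⟨j, h⟩
          · exact absurd hd (not_lt.2 (h _ _ rfl rfl))
        · left; exact h
    _ ≤ 0 + ∑ i : Fin N, δ / N := by
        refine (measure_union_le _ _).trans (add_le_add hclique.le ?_)
        exact (measure_iUnion_fintype_le _ _).trans (Finset.sum_le_sum fun i _ => hT i)
    _ ≤ δ := by
        simp only [zero_add, Finset.sum_const, Finset.card_univ, Fintype.card_fin, nsmul_eq_mul]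
        exact ENNReal.mul_div_le

theorem stmt2 {X : Type*} [MetricSpace X] [PolishSpace X] [MeasurableSpace X] [BorelSpace X]
    (N : ℕ) (hN : 2 ≤ N)
    (ρ : Measure X) [IsProbabilityMeasure ρ]
    (α : ℝ) (hα : 0 < α)
    (hκ : (⨆ x : X, ρ (closedBall x α)) ≤ (N : ℝ≥0∞)⁻¹) :
    ∃ lam : Measure (Fin N → X), IsProbabilityMeasure lam ∧
      (∀ i : Fin N, lam.map (fun x => x i) = ρ) ∧
      lam {x : Fin N → X | ∃ i j : Fin N, i ≠ j ∧ dist (x i) (x j) < α} = 0 := by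
  let e : ℕ → ℝ := fun n => 1 / ((n : ℝ) + 1)
  have he : ∀ n, 0 < e n := fun n => by simp only [e]; positivity
  have he0 : Filter.Tendsto e Filter.atTop (nhds 0) := tendsto_one_div_add_atTop_nhds_zero_nat
  have hex := fun n => approx_coupling N hN ρ α hκ (e n) (he n) (ENNReal.ofReal (e n))
    (ENNReal.ofReal_pos.2 (he n))
  choose l hl hlm hlb using hex
  let μ : ℕ → ProbabilityMeasure (Fin N → X) := fun n => ⟨l n, hl n⟩
  let S : Set (ProbabilityMeasure (Fin N → X)) :=
    {m | ∀ i, (m : Measure (Fin N → X)).map (fun x => x i) = ρ}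
  have htight : IsTightMeasureSet {((m : ProbabilityMeasure (Fin N → X)) :
      Measure (Fin N → X)) | m ∈ S} := by
    rw [isTightMeasureSet_iff_exists_isCompact_measure_compl_le]
    intro δ hδ
    have hρ : IsTightMeasureSet {ρ} := isTightMeasureSet_singleton
    rw [isTightMeasureSet_iff_exists_isCompact_measure_compl_le] at hρ
    obtain ⟨K, hK, hKρ⟩ := hρ (δ / N) (ENNReal.div_pos hδ.ne' (by simp))
    refine ⟨Set.univ.pi fun _ => K, isCompact_univ_pi fun _ => hK, ?_⟩
    rintro _ ⟨m, hm, rfl⟩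
    have hsub : (Set.univ.pi fun _ : Fin N => K)ᶜ ⊆ ⋃ i : Fin N, (fun x : Fin N → X => x i) ⁻¹' Kᶜ := by
      intro x hx
      simp only [Set.mem_compl_iff, Set.mem_pi, Set.mem_univ, true_implies, not_forall] at hx
      simpa using hx
    calc (m : Measure (Fin N → X)) (Set.univ.pi fun _ : Fin N => K)ᶜ
        ≤ ∑ i : Fin N, (m : Measure (Fin N → X)) ((fun x : Fin N → X => x i) ⁻¹' Kᶜ) :=
          (measure_mono hsub).trans (measure_iUnion_fintype_le _ _)
      _ ≤ ∑ i : Fin N, δ / N := by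
          refine Finset.sum_le_sum fun i _ => ?_
          rw [← Measure.map_apply (measurable_pi_apply i) hK.measurableSet.compl, hm i]
          exact hKρ ρ rfl
      _ ≤ δ := by
        simp only [Finset.sum_const, Finset.card_univ, Fintype.card_fin, nsmul_eq_mul]
        exact ENNReal.mul_div_le
  have hcomp := isCompact_closure_of_isTightMeasureSet htight
  let F : Ultrafilter ℕ := Filter.hyperfilter ℕ
  have hF : (F : Filter ℕ) ≤ Filter.atTop := Nat.hyperfilter_le_atTop
  obtain ⟨m, -, hm⟩ := hcomp.ultrafilter_le_nhds (F.map μ) (by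
    rw [Filter.le_principal_iff]
    exact Filter.mem_map.2 (Filter.univ_mem' fun n => subset_closure (hlm n)))
  have hlim : Filter.Tendsto μ F (nhds m) := hm
  refine ⟨m, inferInstance, ?_, ?_⟩
  · intro i
    have h1 := ProbabilityMeasure.tendsto_map_of_tendsto_of_continuous μ m hlim
      (continuous_apply i (A := fun _ : Fin N => X))
    have h2 : ∀ n, (μ n).map (continuous_apply i (A := fun _ : Fin N => X)).measurable.aemeasurable
        = (⟨ρ, inferInstance⟩ : ProbabilityMeasure X) := by
      intro n
      apply Subtype.ext
      exact hlm n i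
    simp only [h2] at h1
    have h3 := tendsto_nhds_unique h1 tendsto_const_nhds
    exact congrArg Subtype.val h3
  · have hU : ∀ k, (m : Measure (Fin N → X))
        {x | ∃ i j : Fin N, i ≠ j ∧ dist (x i) (x j) < α - e k} = 0 := by
      intro k
      have hopen : IsOpen {x : Fin N → X | ∃ i j : Fin N, i ≠ j ∧ dist (x i) (x j) < α - e k} := by
        simp only [Set.ofPred_exists, Set.ofPred_and]
        refine isOpen_iUnion fun i => isOpen_iUnion fun j => ?_
        refine IsOpen.inter isOpen_const ?_
        exact isOpen_lt (by fun_prop) (by fun_prop)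
      have h1 := ProbabilityMeasure.le_liminf_measure_open_of_tendsto hlim hopen
      have h2 : Filter.Tendsto (fun n => (μ n : Measure (Fin N → X))
          {x | ∃ i j : Fin N, i ≠ j ∧ dist (x i) (x j) < α - e k}) F (nhds 0) := by
        refine Filter.Tendsto.mono_left ?_ hF
        have h3 : Filter.Tendsto (fun n => ENNReal.ofReal (e n)) Filter.atTop (nhds 0) := by
          simpa using ENNReal.tendsto_ofReal he0
        refine tendsto_of_tendsto_of_tendsto_of_le_of_le' tendsto_const_nhds h3
          (Filter.Eventually.of_forall fun _ => zero_le) ?_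
        filter_upwards [Filter.eventually_ge_atTop k] with n hn
        refine le_trans (measure_mono ?_) (hlb n)
        rintro x ⟨i, j, hij, hd⟩
        refine ⟨i, j, hij, hd.trans_le ?_⟩
        have : e n ≤ e k := by
          simp only [e]
          gcongr
        linarith
      rw [h2.liminf_eq] at h1
      exact le_antisymm h1 zero_le
    refine measure_mono_null ?_ (measure_iUnion_null hU)
    rintro x ⟨i, j, hij, hd⟩
    obtain ⟨k, hk⟩ := (he0.eventually_lt_const (sub_pos.2 hd)).exists
    exact Set.mem_iUnion.2 ⟨k, i, j, hij, by linarith⟩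
end

section
/- Let (X,d) be a Polish space, N ≥ 2, ρ a Borel probability measure on X, and h : [0,∞) → (0,∞] a strictly decreasing continuous function with inverse h^{-1} defined on the range of h. Define the supremal repulsive cost 𝒞_∞(ρ) := inf over N-couplings λ of ρ of the λ-essential supremum of c(x_1,…,x_N) := Σ_{1≤i<j≤N} h(d(x_i,x_j)). If 𝒞_∞(ρ) is finite and 𝒞_∞(ρ)/(N(N−1)) belongs to the range of h, then κ_ρ( h^{-1}( 𝒞_∞(ρ)/(N(N−1)) ) ) > 1/N, where κ_ρ(α) := sup_{x∈X} ρ(B̄(x,α)). -/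
open MeasureTheory Metric ENNReal

lemma greedy_aux {V : Type*} [DecidableEq V] (c : ℝ) (hc : 0 < c) (R : V → V → Prop)
    (hrefl : ∀ v, R v v) (hsymm : ∀ u v, R u v → R v u) (p F : V → ℝ) (p0 : ∀ v, 0 ≤ p v) (S : Finset V)
    (hR : ∀ v ∈ S, ∀ U ⊆ S, (∀ u ∈ U, R v u) → ∑ u ∈ U, p u ≤ c) (k : ℕ) :
    ∀ (U : Finset V) (B : ℝ), U ⊆ S → (∀ u ∈ U, F u ≤ B) → (k : ℝ) * c ≤ ∑ u ∈ U, p u →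
    ∃ (t : Fin k → V) (L : ℝ), L ≤ B ∧ (∀ i, t i ∈ U) ∧ (∀ i j, i ≠ j → ¬ R (t i) (t j)) ∧
      ∑ u ∈ U, F u * p u ≤ c * ∑ i, F (t i) + (∑ u ∈ U, p u - k * c) * L := by
  classical
  induction k with
  | zero =>
    intro U B hU hB _
    refine ⟨Fin.elim0, B, le_rfl, fun i => i.elim0, fun i => i.elim0, ?_⟩
    simp only [Finset.univ_eq_empty, Finset.sum_empty, mul_zero, Nat.cast_zero, zero_mul, sub_zero, zero_add,
      Finset.sum_mul]
    refine Finset.sum_le_sum fun u hu => ?_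
    rw [mul_comm]
    exact mul_le_mul_of_nonneg_left (hB u hu) (p0 u)
  | succ k ih =>
    intro U B hU hB hk
    push_cast at hk
    have hne : U.Nonempty := by
      rw [Finset.nonempty_iff_ne_empty]
      rintro rfl
      simp only [Finset.sum_empty] at hk
      have : 0 < ((k : ℝ) + 1) * c := by positivity
      linarith
    obtain ⟨v, hv, hmax⟩ := Finset.exists_max_image U F hne
    have hsplit := Finset.sum_filter_add_sum_filter_not U (fun u => R v u) p
    have hsplit2 := Finset.sum_filter_add_sum_filter_not U (fun u => R v u) (fun u => F u * p u)
    have hm := hR v (hU hv) (U.filter (fun u => R v u)) ((Finset.filter_subset _ _).trans hU)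
      (fun u hu => (Finset.mem_filter.1 hu).2)
    obtain ⟨t, L, hL, htU, hti, hs⟩ := ih (U.filter (fun u => ¬ R v u)) (F v)
      ((Finset.filter_subset _ _).trans hU) (fun u hu => hmax u (Finset.mem_filter.1 hu).1) (by linarith)
    refine ⟨Fin.cons v t, L, hL.trans (hB v hv), ?_, ?_, ?_⟩
    · intro i
      refine Fin.cases ?_ (fun i => ?_) i
      · simpa using hv
      · simpa using (Finset.mem_filter.1 (htU i)).1
    · intro i j
      refine Fin.cases ?_ (fun i => ?_) i <;> refine Fin.cases ?_ (fun j => ?_) j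
      · simp
      · intro _; simpa using (Finset.mem_filter.1 (htU j)).2
      · intro _ hh
        exact (Finset.mem_filter.1 (htU i)).2 (hsymm _ _ (by simpa using hh))
      · intro hij; simpa using hti i j (fun hh => hij (by rw [hh]))
    · rw [Fin.sum_univ_succ]
      simp only [Fin.cons_zero, Fin.cons_succ]
      have h1 : ∑ u ∈ U.filter (fun u => R v u), F u * p u ≤ F v * ∑ u ∈ U.filter (fun u => R v u), p u := by
        rw [Finset.mul_sum]
        exact Finset.sum_le_sum fun u hu =>
          mul_le_mul_of_nonneg_right (hmax u (Finset.mem_filter.1 hu).1) (p0 u)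
      push_cast
      rw [← hsplit, ← hsplit2]
      nlinarith [mul_nonneg (sub_nonneg.2 hm) (sub_nonneg.2 hL)]

lemma finite_coupling {V : Type*} [DecidableEq V] (N : ℕ) (hN : 0 < N) (R : V → V → Prop)
    (hrefl : ∀ v, R v v) (hsymm : ∀ u v, R u v → R v u) (p : V → ℝ) (p0 : ∀ v, 0 ≤ p v) (S : Finset V)
    (hp : ∑ v ∈ S, p v = 1)
    (hR : ∀ v ∈ S, ∀ U ⊆ S, (∀ u ∈ U, R v u) → ∑ u ∈ U, p u ≤ (N : ℝ)⁻¹) :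
    ∃ w : (Fin N → V) → ℝ, (∀ t, 0 ≤ w t) ∧
      (∀ t, w t ≠ 0 → (∀ i, t i ∈ S) ∧ ∀ i j, i ≠ j → ¬ R (t i) (t j)) ∧
      ∀ i, ∀ v ∈ S, ∑ t ∈ Fintype.piFinset (fun _ : Fin N => S), (if t i = v then w t else 0) = p v := by
  classical
  have : NeZero N := ⟨hN.ne'⟩
  have hNr : (0 : ℝ) < N := by exact_mod_cast hN
  set I : Finset (Fin N → V) := (Fintype.piFinset (fun _ : Fin N => S)).filter
    (fun t => ∀ i j, i ≠ j → ¬ R (t i) (t j)) with hI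
  let pt : (Fin N → V) → (Fin N → V → ℝ) := fun t i v => if t i = v then 1 else 0
  have hinj : Function.Injective pt := by
    intro s t hst
    funext i
    have := congrFun (congrFun hst i) (t i)
    by_contra hne
    simp [pt, hne] at this
  let q : Fin N → V → ℝ := fun _ v => if v ∈ S then p v else 0
  have hq : q ∈ convexHull ℝ ((I.image pt : Finset _) : Set (Fin N → V → ℝ)) := by
    by_contra hcon
    have hcl : IsClosed (convexHull ℝ ((I.image pt : Finset _) : Set (Fin N → V → ℝ))) :=
      ((Finset.finite_toSet (I.image pt)).isCompact_convexHull (𝕜 := ℝ)).isClosed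
    obtain ⟨f, u, hf1, hf2⟩ := geometric_hahn_banach_closed_point (convex_convexHull ℝ _) hcl hcon
    let e : Fin N → V → (Fin N → V → ℝ) := fun i v => Pi.single i (Pi.single v 1)
    let F : V → ℝ := fun v => ∑ i, f (e i v)
    have hfpt : ∀ t, f (pt t) = ∑ i, f (e i (t i)) := by
      intro t
      rw [← map_sum]
      congr 1
      funext i v
      rw [Finset.sum_apply, Finset.sum_apply, Finset.sum_eq_single i]
      · simp [e, pt, Pi.single_apply, eq_comm]
      · intro j _ hj
        simp [e, Pi.single_eq_of_ne hj.symm]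
      · simp
    have hfq : f q = ∑ v ∈ S, F v * p v := by
      have : q = ∑ v ∈ S, p v • ∑ i, e i v := by
        funext i v
        simp [e, q, Finset.sum_apply, Pi.single_apply]
      rw [this]
      simp [F, mul_comm]
    obtain ⟨t, L, -, htS, hti, hs⟩ := greedy_aux (N : ℝ)⁻¹ (by positivity) R hrefl hsymm p F p0 S hR N S
      (∑ v ∈ S, |F v|) le_rfl
      (fun v hv => (le_abs_self _).trans
        (Finset.single_le_sum (f := fun v => |F v|) (fun _ _ => abs_nonneg _) hv))
      (by rw [hp, mul_inv_cancel₀ hNr.ne'])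
    rw [hp, mul_inv_cancel₀ hNr.ne', sub_self, zero_mul, add_zero, ← hfq] at hs
    have h1 : ∀ k : Fin N, f (pt (fun i => t (i + k))) < u := by
      intro k
      apply hf1
      apply subset_convexHull
      simp only [Finset.coe_image, Set.mem_image, Finset.mem_coe]
      refine ⟨_, ?_, rfl⟩
      simp only [hI, Finset.mem_filter, Fintype.mem_piFinset]
      exact ⟨fun i => htS _, fun i j hij => hti _ _ (fun h => hij (add_right_cancel h))⟩
    have h2 : ∑ k : Fin N, f (pt (fun i => t (i + k))) = ∑ i, F (t i) := by
      simp only [hfpt, F]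
      rw [Finset.sum_comm, Finset.sum_comm (s := Finset.univ) (t := Finset.univ) (f := fun i j => f (e j (t i)))]
      refine Finset.sum_congr rfl fun i _ => ?_
      exact Fintype.sum_equiv (Equiv.addLeft i) _ _ (fun k => by simp)
    have h3 : ∑ i, F (t i) ≤ N * u := by
      rw [← h2]
      calc _ ≤ ∑ k : Fin N, u := Finset.sum_le_sum fun k _ => (h1 k).le
        _ = N * u := by simp
    have : (N : ℝ)⁻¹ * ∑ i, F (t i) ≤ u := by
      rw [inv_mul_le_iff₀ hNr]; exact h3
    linarith
  rw [Finset.mem_convexHull'] at hq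
  obtain ⟨w, w0, w1, hw⟩ := hq
  rw [Finset.sum_image (fun _ _ _ _ h => hinj h)] at hw
  refine ⟨fun t => if t ∈ I then w (pt t) else 0, ?_, ?_, ?_⟩
  · intro t
    dsimp only
    split_ifs with ht
    · exact w0 _ (Finset.mem_image_of_mem _ ht)
    · exact le_rfl
  · intro t ht
    have : t ∈ I := by by_contra hh; simp [hh] at ht
    simpa [hI] using this
  · intro i v hv
    have := congrFun (congrFun hw i) v
    simp only [Finset.sum_apply, Pi.smul_apply, q, hv, if_true, pt, smul_eq_mul, mul_ite, mul_one, mul_zero] at this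
    rw [← this, hI, Finset.sum_filter]
    refine Finset.sum_congr rfl fun t ht => ?_
    simp only [Finset.mem_filter, ht, true_and]
    split_ifs <;> rfl

lemma countable_coupling (N : ℕ) (hN : 0 < N) (R : ℕ → ℕ → Prop)
    (hrefl : ∀ v, R v v) (hsymm : ∀ u v, R u v → R v u) (p : ℕ → ℝ) (p0 : ∀ v, 0 ≤ p v)
    (hp : HasSum p 1)
    (hR : ∀ v, ∀ U : Finset ℕ, (∀ u ∈ U, R v u) → ∑ u ∈ U, p u ≤ (N : ℝ)⁻¹) :
    ∃ w : (Fin N → ℕ) → ℝ≥0∞,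
      (∀ t, w t ≠ 0 → ∀ i j, i ≠ j → ¬ R (t i) (t j)) ∧
      ∀ i v, ∑' t, (if t i = v then w t else 0) = ENNReal.ofReal (p v) := by
  classical
  have hNr : (0 : ℝ) < N := by exact_mod_cast hN
  have htend := hp.tendsto_sum_nat
  have hle1 : ∀ n, ∑ i ∈ Finset.range n, p i ≤ 1 := fun n => sum_le_hasSum _ (fun i _ => p0 i) hp
  obtain ⟨M0, hM0⟩ : ∃ M0, ∀ n ≥ M0, 1 - ∑ i ∈ Finset.range n, p i ≤ (N : ℝ)⁻¹ := by
    have : ∀ᶠ n in Filter.atTop, 1 - (N : ℝ)⁻¹ < ∑ i ∈ Finset.range n, p i :=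
      htend.eventually (lt_mem_nhds (by have : (0 : ℝ) < (N : ℝ)⁻¹ := by positivity
                                        linarith))
    obtain ⟨M0, h⟩ := Filter.eventually_atTop.1 this
    exact ⟨M0, fun n hn => by linarith [h n hn]⟩
  have key : ∀ n : ℕ, ∃ w : (Fin N → ℕ) → ℝ, (∀ t, 0 ≤ w t) ∧ (∀ t, w t ≤ 1) ∧
      (∀ t, (∀ i, t i < n + M0) → w t ≠ 0 → ∀ i j, i ≠ j → ¬ R (t i) (t j)) ∧
      (∀ (T : Finset (Fin N → ℕ)) (i : Fin N) (v : ℕ), v < n + M0 →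
        ∑ t ∈ T, (if t i = v then w t else 0) ≤ p v) ∧
      (∀ K, K ≤ n + M0 → 1 - N * (1 - ∑ v ∈ Finset.range K, p v) ≤
        ∑ t ∈ Fintype.piFinset (fun _ : Fin N => Finset.range K), w t) := by
    intro n
    set M := n + M0 with hM
    let q : ℕ → ℝ := fun v => if v < M then p v else 1 - ∑ i ∈ Finset.range M, p i
    let R' : ℕ → ℕ → Prop := fun a b => a = b ∨ (a ≠ M ∧ b ≠ M ∧ R a b)
    have hqs : ∀ U : Finset ℕ, (∀ u ∈ U, u < M) → ∑ u ∈ U, q u = ∑ u ∈ U, p u := fun U hU =>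
      Finset.sum_congr rfl fun u hu => by simp [q, hU u hu]
    have hqM : q M = 1 - ∑ i ∈ Finset.range M, p i := by simp [q]
    have hq0 : ∀ v, 0 ≤ q v := by
      intro v
      dsimp only [q]
      split_ifs
      · exact p0 v
      · linarith [hle1 M]
    have hq1 : ∑ v ∈ Finset.range (M + 1), q v = 1 := by
      rw [Finset.sum_range_succ, hqs _ (fun u hu => Finset.mem_range.1 hu), hqM]; ring
    obtain ⟨w, w0, wi, wm⟩ := finite_coupling N hN R' (fun v => Or.inl rfl)
      (fun u v h => h.elim (fun h => Or.inl h.symm) (fun h => Or.inr ⟨h.2.1, h.1, hsymm _ _ h.2.2⟩))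
      q hq0 (Finset.range (M + 1)) hq1 (by
        intro v hv U hU hUR
        rw [Finset.mem_range] at hv
        by_cases hvM : v = M
        · have : U ⊆ {M} := by
            intro u hu
            rcases hUR u hu with h | h
            · simp [← h, hvM]
            · exact absurd hvM h.1
          calc ∑ u ∈ U, q u ≤ ∑ u ∈ {M}, q u :=
                Finset.sum_le_sum_of_subset_of_nonneg this (fun _ _ _ => hq0 _)
            _ ≤ _ := by rw [Finset.sum_singleton, hqM]; exact hM0 M (by omega)
        · rw [hqs]
          · exact hR v U fun u hu => (hUR u hu).elim (fun h => h ▸ hrefl v) (fun h => h.2.2)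
          · intro u hu
            have h1 := Finset.mem_range.1 (hU hu)
            rcases hUR u hu with h | h
            · omega
            · have := h.2.1; omega)
    set P := Fintype.piFinset (fun _ : Fin N => Finset.range (M + 1)) with hP
    have wP : ∀ t, t ∉ P → w t = 0 := by
      intro t ht
      by_contra hne
      exact ht (Fintype.mem_piFinset.2 (wi t hne).1)
    have wtot : ∑ t ∈ P, w t = 1 := by
      rw [← hq1]
      let i0 : Fin N := ⟨0, hN⟩
      rw [Finset.sum_congr rfl (fun v hv => (wm i0 v hv).symm), Finset.sum_comm]
      refine Finset.sum_congr rfl fun t ht => ?_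
      rw [Finset.sum_ite_eq, if_pos (Fintype.mem_piFinset.1 ht i0)]
    have wT : ∀ (T : Finset (Fin N → ℕ)) (i : Fin N) (v : ℕ), v < M →
        ∑ t ∈ T, (if t i = v then w t else 0) ≤ p v := by
      intro T i v hv
      have h1 : p v = q v := by simp [q, hv]
      rw [h1, ← wm i v (Finset.mem_range.2 (by omega))]
      have hnn : ∀ t, 0 ≤ (if t i = v then w t else 0) := fun t => by
        split_ifs
        · exact w0 t
        · exact le_rfl
      calc _ ≤ ∑ t ∈ T ∪ P, (if t i = v then w t else 0) :=
            Finset.sum_le_sum_of_subset_of_nonneg Finset.subset_union_left (fun _ _ _ => hnn _)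
        _ = _ := (Finset.sum_subset Finset.subset_union_right
            (fun t _ ht => by simp [wP t ht])).symm
    refine ⟨w, w0, ?_, ?_, wT, ?_⟩
    · intro t
      by_cases ht : t ∈ P
      · rw [← wtot]; exact Finset.single_le_sum (fun t _ => w0 t) ht
      · rw [wP t ht]; exact zero_le_one
    · intro t ht hw i j hij hRij
      exact (wi t hw).2 i j hij (Or.inr ⟨(ht i).ne, (ht j).ne, hRij⟩)
    · intro K hK
      set Q := Fintype.piFinset (fun _ : Fin N => Finset.range K) with hQ
      have hQP : Q ⊆ P := Fintype.piFinset_subset _ _ fun _ => by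
        intro x hx; simp only [Finset.mem_range] at hx ⊢; omega
      have hpt : ∀ t ∈ P, w t ≤ (if t ∈ Q then w t else 0) +
          ∑ i : Fin N, (w t - ∑ v ∈ Finset.range K, (if t i = v then w t else 0)) := by
        intro t _
        have hnn : ∀ i : Fin N, 0 ≤ w t - ∑ v ∈ Finset.range K, (if t i = v then w t else 0) := by
          intro i
          rw [Finset.sum_ite_eq]
          split_ifs
          · simp
          · simpa using w0 t
        split_ifs with htQ
        · have := Finset.sum_nonneg (fun i (_ : i ∈ (Finset.univ : Finset (Fin N))) => hnn i)
          linarith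
        · rw [hQ, Fintype.mem_piFinset] at htQ
          push Not at htQ
          obtain ⟨i, hi⟩ := htQ
          have := Finset.single_le_sum (fun i (_ : i ∈ (Finset.univ : Finset (Fin N))) => hnn i) (Finset.mem_univ i)
          refine le_trans ?_ (this.trans (le_of_eq (zero_add _).symm))
          rw [Finset.sum_ite_eq, if_neg hi, sub_zero]
      have hsum := Finset.sum_le_sum hpt
      rw [wtot, Finset.sum_add_distrib, Finset.sum_comm] at hsum
      have h2 : ∀ i : Fin N, ∑ t ∈ P, (w t - ∑ v ∈ Finset.range K, (if t i = v then w t else 0))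
          = 1 - ∑ v ∈ Finset.range K, p v := by
        intro i
        rw [Finset.sum_sub_distrib, wtot, Finset.sum_comm]
        congr 1
        refine Finset.sum_congr rfl fun v hv => ?_
        have hv' := Finset.mem_range.1 hv
        rw [wm i v (Finset.mem_range.2 (by omega))]
        have : v < M := by omega
        simp [q, this]
      have h3 : ∑ t ∈ P, (if t ∈ Q then w t else 0) = ∑ t ∈ Q, w t := by
        rw [← Finset.sum_filter]
        congr 1
        ext t
        simp only [Finset.mem_filter, and_iff_right_iff_imp]
        exact fun h => hQP h
      rw [h3, Finset.sum_congr rfl (fun i _ => h2 i)] at hsum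
      simp only [Finset.sum_const, Finset.card_univ, Fintype.card_fin, nsmul_eq_mul] at hsum
      linarith
  choose w w0 w1 wi wm wK using key
  have hcomp : IsCompact (Set.univ.pi (fun _ : Fin N → ℕ => Set.Icc (0 : ℝ) 1)) :=
    isCompact_univ_pi fun _ => isCompact_Icc
  obtain ⟨W, hW, φ, hφ, hlim⟩ := hcomp.tendsto_subseq (x := w) (fun n t _ => ⟨w0 n t, w1 n t⟩)
  rw [tendsto_pi_nhds] at hlim
  have W0 : ∀ t, 0 ≤ W t := fun t => (hW t (Set.mem_univ _)).1
  have hev : ∀ K : ℕ, ∀ᶠ n in Filter.atTop, K < φ n + M0 := by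
    intro K
    filter_upwards [Filter.eventually_gt_atTop K] with n hn
    have := hφ.id_le n
    simp only [id] at this
    omega
  have Wi : ∀ t, W t ≠ 0 → ∀ i j, i ≠ j → ¬ R (t i) (t j) := by
    intro t ht i j hij hRij
    apply ht
    refine tendsto_nhds_unique (hlim t) (tendsto_const_nhds.congr' ?_)
    have : ∀ᶠ n in Filter.atTop, ∀ i, t i < φ n + M0 := Filter.eventually_all.2 fun i => hev (t i)
    filter_upwards [this] with n hn
    by_contra hne
    exact wi (φ n) t hn (Ne.symm hne) i j hij hRij
  have Wm : ∀ (T : Finset (Fin N → ℕ)) (i : Fin N) (v : ℕ),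
      ∑ t ∈ T, (if t i = v then W t else 0) ≤ p v := by
    intro T i v
    have : Filter.Tendsto (fun n => ∑ t ∈ T, (if t i = v then w (φ n) t else 0)) Filter.atTop
        (nhds (∑ t ∈ T, (if t i = v then W t else 0))) := by
      refine tendsto_finsetSum _ fun t _ => ?_
      split_ifs
      · exact hlim t
      · exact tendsto_const_nhds
    refine le_of_tendsto this ?_
    filter_upwards [hev v] with n hn using wm (φ n) T i v hn
  have WK : ∀ K, 1 - N * (1 - ∑ v ∈ Finset.range K, p v) ≤
        ∑ t ∈ Fintype.piFinset (fun _ : Fin N => Finset.range K), W t := by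
    intro K
    refine ge_of_tendsto (tendsto_finsetSum _ fun t _ => hlim t) ?_
    filter_upwards [hev K] with n hn using wK (φ n) K hn.le
  refine ⟨fun t => ENNReal.ofReal (W t), ?_, ?_⟩
  · intro t ht
    apply Wi t
    rintro h0
    simp [h0] at ht
  intro i
  have hle : ∀ v, ∑' t : Fin N → ℕ, (if t i = v then ENNReal.ofReal (W t) else 0) ≤ ENNReal.ofReal (p v) := by
    intro v
    rw [ENNReal.tsum_eq_iSup_sum]
    refine iSup_le fun T => ?_
    refine le_trans (le_of_eq ?_) (ENNReal.ofReal_le_ofReal (Wm T i v))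
    rw [ENNReal.ofReal_sum_of_nonneg]
    · refine Finset.sum_congr rfl fun t _ => ?_
      split_ifs <;> simp
    · intro t _
      split_ifs
      · exact W0 t
      · exact le_rfl
  have hp1 : ∑' v, ENNReal.ofReal (p v) = 1 := by
    rw [← ENNReal.ofReal_tsum_of_nonneg p0 hp.summable, hp.tsum_eq, ENNReal.ofReal_one]
  have htot : 1 ≤ ∑' v : ℕ, ∑' t : Fin N → ℕ, (if t i = v then ENNReal.ofReal (W t) else 0) := by
    rw [ENNReal.tsum_comm]
    have h1 : ∀ t : Fin N → ℕ, ∑' v : ℕ, (if t i = v then ENNReal.ofReal (W t) else 0) = ENNReal.ofReal (W t) := by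
      intro t
      rw [tsum_eq_single (t i) (fun v hv => if_neg hv.symm), if_pos rfl]
    simp_rw [h1]
    have h2 : Filter.Tendsto (fun K => ENNReal.ofReal (1 - N * (1 - ∑ v ∈ Finset.range K, p v)))
        Filter.atTop (nhds 1) := by
      have := ENNReal.tendsto_ofReal
        ((tendsto_const_nhds (x := (1 : ℝ))).sub ((tendsto_const_nhds (x := (N : ℝ))).mul
          ((tendsto_const_nhds (x := (1 : ℝ))).sub htend)))
      simpa using this
    refine le_of_tendsto h2 (Filter.Eventually.of_forall fun K => ?_)
    refine (ENNReal.ofReal_le_ofReal (WK K)).trans ?_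
    rw [ENNReal.ofReal_sum_of_nonneg (fun t _ => W0 t)]
    exact ENNReal.sum_le_tsum _
  intro v
  by_contra hne
  have hlt := lt_of_le_of_ne (hle v) hne
  have := ENNReal.tsum_lt_tsum
    (ne_top_of_le_ne_top (by rw [hp1]; exact ENNReal.one_ne_top) (ENNReal.tsum_le_tsum hle)) hle hlt
  rw [hp1] at this
  exact absurd this (not_lt.2 htot)

lemma coupling_exists {X : Type*} [MetricSpace X] [PolishSpace X] [MeasurableSpace X] [BorelSpace X]
    (N : ℕ) (hN : 0 < N) (ρ : Measure X) [IsProbabilityMeasure ρ] (α α' : ℝ) (hα : 0 < α)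
    (hα' : α' < α) (hk : ∀ x, ρ (closedBall x α) ≤ (N : ℝ≥0∞)⁻¹) :
    ∃ lam : Measure (Fin N → X), (IsProbabilityMeasure lam ∧ ∀ i : Fin N, lam.map (fun x => x i) = ρ) ∧
      ∀ᵐ x ∂lam, ∀ i j, i ≠ j → α' ≤ dist (x i) (x j) := by
  classical
  have hne : Nonempty X := ρ.nonempty_of_neZero
  obtain ⟨ε, hε, hε1, hε2⟩ : ∃ ε : ℝ, 0 < ε ∧ ε ≤ α ∧ 3 * ε ≤ α - α' :=
    ⟨min α ((α - α') / 3), lt_min hα (by linarith), min_le_left _ _,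
      by linarith [min_le_right α ((α - α') / 3)]⟩
  let u : ℕ → X := TopologicalSpace.denseSeq X
  have hu : ∀ x, ∃ n, dist x (u n) < ε := fun x =>
    (TopologicalSpace.denseRange_denseSeq X).exists_dist_lt x hε
  let T : X → ℕ := fun x => Nat.find (hu x)
  have hT : ∀ x, dist x (u (T x)) < ε := fun x => Nat.find_spec (hu x)
  have hTm : Measurable T := measurable_find hu fun n => by
    have : {x | dist x (u n) < ε} = ball (u n) ε := rfl
    rw [this]; exact measurableSet_ball
  let A : ℕ → Set X := fun n => T ⁻¹' {n}
  have hA : ∀ n, MeasurableSet (A n) := fun n => hTm (measurableSet_singleton n)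
  have hAU : ∀ U : Finset ℕ, ∑ n ∈ U, ρ (A n) = ρ (T ⁻¹' U) := fun U =>
    sum_measure_preimage_singleton U fun n _ => hA n
  let p : ℕ → ℝ := fun n => (ρ (A n)).toReal
  have hpof : ∀ n, ENNReal.ofReal (p n) = ρ (A n) := fun n => ENNReal.ofReal_toReal (measure_ne_top _ _)
  have hAdisj : Pairwise (Function.onFun Disjoint A) := fun m n hmn =>
    Disjoint.preimage _ (by simpa using hmn)
  have hAun : ⋃ n, A n = Set.univ := by
    ext x; simp [A]
  have hAs : ∑' n, ρ (A n) = 1 := by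
    rw [← measure_iUnion hAdisj hA, hAun, measure_univ]
  have hp : HasSum p 1 := by
    have := ENNReal.hasSum_toReal (f := fun n => ρ (A n)) (by rw [hAs]; exact ENNReal.one_ne_top)
    rwa [← ENNReal.tsum_toReal_eq (fun _ => measure_ne_top _ _), hAs, ENNReal.toReal_one] at this
  obtain ⟨w, wi, wm⟩ := countable_coupling N hN (fun m n => dist (u m) (u n) ≤ α - ε)
    (fun v => by rw [dist_self]; linarith) (fun m n h => by rwa [dist_comm]) p
    (fun n => ENNReal.toReal_nonneg) hp (by
      intro v U hU
      have h1 : ρ (T ⁻¹' U) ≤ (N : ℝ≥0∞)⁻¹ := by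
        refine le_trans (measure_mono ?_) (hk (u v))
        intro x hx
        have h2 := hU (T x) (by simpa using hx)
        have h3 := hT x
        have h4 := dist_triangle x (u (T x)) (u v)
        rw [dist_comm (u (T x)) (u v)] at h4
        rw [mem_closedBall]; linarith
      rw [← ENNReal.toReal_sum (fun _ _ => measure_ne_top _ _), hAU]
      have := ENNReal.toReal_mono (by simp [hN.ne']) h1
      simpa using this)
  have wm' : ∀ i v, ∑' t, (if t i = v then w t else 0) = ρ (A v) := fun i v => by rw [wm, hpof]
  let ν : ℕ → Measure X := fun n => if ρ (A n) = 0 then ρ else ProbabilityTheory.cond ρ (A n)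
  have hν : ∀ n, IsProbabilityMeasure (ν n) := by
    intro n
    dsimp only [ν]
    split_ifs with h
    · infer_instance
    · exact ProbabilityTheory.cond_isProbabilityMeasure h
  have hνA : ∀ n, ρ (A n) • ν n = ρ.restrict (A n) := by
    intro n
    dsimp only [ν]
    split_ifs with h
    · rw [h, zero_smul, Measure.restrict_eq_zero.2 h]
    · rw [ProbabilityTheory.cond, smul_smul, ENNReal.mul_inv_cancel h (measure_ne_top _ _), one_smul]
  have hνae : ∀ n, ρ (A n) ≠ 0 → ∀ᵐ x ∂ν n, x ∈ A n := by
    intro n h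
    simp only [ν, if_neg h]
    exact ProbabilityTheory.ae_cond_mem (hA n)
  let lam : Measure (Fin N → X) := Measure.sum fun t : Fin N → ℕ => w t • Measure.pi (fun i => ν (t i))
  have hmarg : ∀ i : Fin N, lam.map (fun x => x i) = ρ := by
    intro i
    have h1 : lam.map (fun x => x i) = Measure.sum fun t : Fin N → ℕ => w t • ν (t i) := by
      rw [Measure.map_sum (measurable_pi_apply i).aemeasurable]
      congr 1
      funext t
      rw [Measure.map_smul]
      congr 1
      exact (measurePreserving_eval (fun i => ν (t i)) i).map_eq
    rw [h1]
    ext s hs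
    rw [Measure.sum_apply _ hs]
    have h2 : ∀ t : Fin N → ℕ, (w t • ν (t i)) s = ∑' v : ℕ, (if t i = v then w t else 0) * ν v s := by
      intro t
      rw [tsum_eq_single (t i) (fun v hv => by rw [if_neg hv.symm, zero_mul]), if_pos rfl]
      simp
    simp_rw [h2]
    rw [ENNReal.tsum_comm]
    simp_rw [ENNReal.tsum_mul_right, wm']
    have h3 : ∀ v, ρ (A v) * ν v s = ρ (s ∩ A v) := by
      intro v
      have := congrArg (fun μ => μ s) (hνA v)
      simpa [Measure.restrict_apply hs] using this
    simp_rw [h3]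
    rw [← measure_iUnion (fun m n hmn => (hAdisj hmn).mono Set.inter_subset_right Set.inter_subset_right)
      (fun n => hs.inter (hA n)), ← Set.inter_iUnion, hAun, Set.inter_univ]
  refine ⟨lam, ⟨?_, hmarg⟩, ?_⟩
  · constructor
    have := congrArg (fun μ => μ Set.univ) (hmarg ⟨0, hN⟩)
    simpa [Measure.map_apply (measurable_pi_apply _) MeasurableSet.univ] using this
  · rw [Measure.ae_sum_iff]
    intro t
    by_cases hw : w t = 0
    · simp [hw]
    apply Measure.ae_smul_measure
    have hpos : ∀ i, ρ (A (t i)) ≠ 0 := by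
      intro i h0
      have := wm' i (t i)
      rw [h0, ENNReal.tsum_eq_zero] at this
      exact hw (by simpa using this t)
    have : ∀ᵐ x ∂Measure.pi (fun i => ν (t i)), ∀ i, x i ∈ A (t i) := by
      rw [ae_all_iff]
      intro i
      exact (measurePreserving_eval (fun i => ν (t i)) i).quasiMeasurePreserving.ae (hνae (t i) (hpos i))
    filter_upwards [this] with x hx i j hij
    have h1 := wi t hw i j hij
    have hi : T (x i) = t i := hx i
    have hj : T (x j) = t j := hx j
    have h2 := hT (x i)
    have h3 := hT (x j)
    rw [hi] at h2
    rw [hj] at h3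
    have h4 := dist_triangle4 (u (t i)) (x i) (x j) (u (t j))
    rw [dist_comm (u (t i)) (x i)] at h4
    push Not at h1
    linarith

lemma card_pairs (N : ℕ) :
    2 * (Finset.univ.filter (fun p : Fin N × Fin N => p.1 < p.2)).card = N * (N - 1) := by
  have h1 : (Finset.univ.filter (fun p : Fin N × Fin N => p.1 < p.2)).card
      = (Finset.univ.filter (fun p : Fin N × Fin N => p.2 < p.1)).card := by
    refine Finset.card_bij (fun p _ => p.swap) ?_ ?_ ?_
    · simp
    · intro a _ b _ h; exact Prod.swap_injective h
    · intro b hb; exact ⟨b.swap, by simpa using hb, by simp⟩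
  have h2 : (Finset.univ.filter (fun p : Fin N × Fin N => p.1 < p.2)) ∪
      (Finset.univ.filter (fun p : Fin N × Fin N => p.2 < p.1)) = (Finset.univ : Finset (Fin N)).offDiag := by
    ext ⟨a, b⟩
    simp [lt_or_lt_iff_ne]
  have h3 : Disjoint (Finset.univ.filter (fun p : Fin N × Fin N => p.1 < p.2))
      (Finset.univ.filter (fun p : Fin N × Fin N => p.2 < p.1)) := by
    rw [Finset.disjoint_filter]
    intro p _ h; exact not_lt.2 h.le
  have h4 := Finset.card_union_of_disjoint h3
  rw [h2, Finset.offDiag_card, ← h1] at h4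
  simp only [Finset.card_univ, Fintype.card_fin] at h4
  rw [Nat.mul_sub, mul_one, two_mul]
  omega

theorem stmt3 {X : Type*} [MetricSpace X] [PolishSpace X] [MeasurableSpace X] [BorelSpace X]
    (N : ℕ) (hN : 2 ≤ N)
    (ρ : Measure X) [IsProbabilityMeasure ρ]
    (h : ℝ → ℝ≥0∞)
    (hpos : ∀ t : ℝ, 0 ≤ t → 0 < h t)
    (hanti : StrictAntiOn h (Set.Ici 0))
    (hcont : ContinuousOn h (Set.Ici 0))
    (Cinf : ℝ≥0∞)
    (hCinf : Cinf = ⨅ (lam : Measure (Fin N → X))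
        (_ : IsProbabilityMeasure lam ∧ ∀ i : Fin N, lam.map (fun x => x i) = ρ),
        essSup (fun x : Fin N → X =>
          ∑ p ∈ Finset.univ.filter (fun p : Fin N × Fin N => p.1 < p.2),
            h (dist (x p.1) (x p.2))) lam)
    (hfin : Cinf ≠ ⊤)
    (α : ℝ) (hα : 0 ≤ α)
    (hinv : h α = Cinf / ((N : ℝ≥0∞) * ((N : ℝ≥0∞) - 1))) :
    (N : ℝ≥0∞)⁻¹ < ⨆ x : X, ρ (closedBall x α) := by
  by_contra hcon
  have hk : ∀ x, ρ (closedBall x α) ≤ (N : ℝ≥0∞)⁻¹ := fun x =>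
    (le_iSup (fun x => ρ (closedBall x α)) x).trans (not_lt.1 hcon)
  set m := (Finset.univ.filter (fun p : Fin N × Fin N => p.1 < p.2)).card with hm
  have hm2 : (N : ℝ≥0∞) * ((N : ℝ≥0∞) - 1) = 2 * m := by
    have := congrArg (fun n : ℕ => (n : ℝ≥0∞)) (card_pairs N)
    simp only [Nat.cast_mul, ENNReal.natCast_sub, Nat.cast_one, Nat.cast_ofNat] at this
    exact this.symm
  have hm0 : m ≠ 0 := by
    intro h0
    have := card_pairs N
    rw [← hm, h0] at this
    have h1 : 0 < N * (N - 1) := Nat.mul_pos (by omega) (by omega)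
    omega
  have hm0' : (m : ℝ≥0∞) ≠ 0 := by exact_mod_cast hm0
  have hC : Cinf = 2 * m * h α := by
    rw [hinv, hm2, ENNReal.mul_div_cancel (by simp [hm0]) (by finiteness)]
  have hαtop : h α ≠ ⊤ := by
    intro ht
    rw [ht, ENNReal.mul_top (by simp [hm0])] at hC
    exact hfin hC
  have hα0 := hpos α hα
  have hlt2 : h α < 2 * h α := by
    rw [two_mul]; exact ENNReal.lt_add_right hαtop hα0.ne'
  have main : ∀ β : ℝ, 0 ≤ β → h β < 2 * h α → ∀ lam : Measure (Fin N → X),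
      (IsProbabilityMeasure lam ∧ ∀ i : Fin N, lam.map (fun x => x i) = ρ) →
      (∀ᵐ x ∂lam, ∀ i j, i ≠ j → β ≤ dist (x i) (x j)) → False := by
    intro β hβ hβα lam hlam hae
    have h1 : Cinf ≤ m * h β := by
      rw [hCinf]
      refine (iInf₂_le lam hlam).trans ?_
      refine essSup_le_of_ae_le _ ?_
      filter_upwards [hae] with x hx
      rw [hm, ← nsmul_eq_mul]
      refine Finset.sum_le_card_nsmul _ _ _ fun p hp => ?_
      have hp' := (Finset.mem_filter.1 hp).2
      exact hanti.antitoneOn hβ dist_nonneg (hx p.1 p.2 hp'.ne)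
    have h2 : (m : ℝ≥0∞) * h β < m * (2 * h α) :=
      (ENNReal.mul_lt_mul_iff_right hm0' (by finiteness)).2 hβα
    have h3 : (m : ℝ≥0∞) * (2 * h α) = Cinf := by rw [hC]; ring
    rw [h3] at h2
    exact absurd h1 (not_le.2 h2)
  rcases hα.eq_or_lt with h0 | hpos'
  · subst h0
    refine main 0 le_rfl hlt2 (Measure.pi fun _ => ρ) ⟨inferInstance, fun i => ?_⟩ ?_
    · exact (measurePreserving_eval (fun _ : Fin N => ρ) i).map_eq
    · exact Filter.Eventually.of_forall fun x i j _ => dist_nonneg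
  · have hc : ContinuousAt h α := hcont.continuousAt (Ici_mem_nhds hpos')
    have hev : ∀ᶠ β in nhds α, h β < 2 * h α := hc.eventually (gt_mem_nhds hlt2)
    have hev2 : ∀ᶠ β in nhdsWithin α (Set.Iio α), h β < 2 * h α ∧ 0 < β ∧ β < α := by
      filter_upwards [nhdsWithin_le_nhds hev, nhdsWithin_le_nhds (lt_mem_nhds hpos'),
        self_mem_nhdsWithin] with β h1 h2 h3 using ⟨h1, h2, h3⟩
    obtain ⟨β, hβ1, hβ2, hβ3⟩ := hev2.exists
    obtain ⟨lam, hlam, hae⟩ := coupling_exists N (by omega) ρ α β hpos' hβ3 hk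
    exact main β hβ2.le hβ1 lam hlam hae
end

section
/- Let (X,d) be a Polish space, ρ a Borel probability measure on X, and α > 0. If κ_ρ(α) := sup_{x∈X} ρ(B̄(x,α)) ≤ 1/2, then there exists a coupling λ of ρ with itself (a probability measure on X×X with both marginals equal to ρ) such that λ({(x,y) : d(x,y) < α}) = 0. -/
open MeasureTheory Metric ENNReal

lemma hall_perm {I : Type*} [Fintype I] [DecidableEq I] (bad : I → I → Prop)
    (hs : ∀ k l, bad k l → bad l k) (M : ℕ)
    (h : ∀ k, 2 * Nat.card {l // bad k l} ≤ Fintype.card I + M) :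
    ∃ σ : Equiv.Perm I, Nat.card {k // bad k (σ k)} ≤ M := by
  classical
  let t : I ⊕ Fin M → Finset (I ⊕ Fin M) := fun v => match v with
    | .inl k => Finset.univ.filter (fun w => ∀ l, w = .inl l → ¬ bad k l)
    | .inr _ => Finset.univ
  have hc : ∀ k, ((t (.inl k))ᶜ).card = Nat.card {l // bad k l} := by
    intro k
    have : (t (.inl k))ᶜ = (Finset.univ.filter (fun l => bad k l)).map Function.Embedding.inl := by
      ext w
      rcases w with w | w <;> simp [t]
    rw [this, Finset.card_map, Nat.card_eq_fintype_card, Fintype.card_subtype]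
  have hall : ∀ s : Finset (I ⊕ Fin M), s.card ≤ (s.biUnion t).card := by
    intro s
    by_cases hu : s.biUnion t = Finset.univ
    · rw [hu]; exact Finset.card_le_univ s
    rcases s.eq_empty_or_nonempty with rfl | ⟨v, hv⟩
    · simp
    obtain ⟨w, hw⟩ : ∃ w, w ∉ s.biUnion t := by
      by_contra hcon
      push Not at hcon
      exact hu (Finset.eq_univ_iff_forall.2 hcon)
    simp only [Finset.mem_biUnion, not_exists, not_and] at hw
    rcases w with l | w
    swap
    · exfalso
      have := hw v hv
      rcases v with v | v <;> simp [t] at this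
    have hsub : s ⊆ (t (.inl l))ᶜ := by
      intro u hu
      have := hw u hu
      rcases u with u | u
      · simp [t] at this ⊢
        exact hs _ _ this
      · simp [t] at this
    have h1 := (Finset.card_le_card hsub).trans (hc l).le
    have h2 : (t v).card ≤ (s.biUnion t).card := Finset.card_le_card (Finset.subset_biUnion_of_mem t hv)
    rcases v with k | v
    · have h3 := Finset.card_compl_add_card (t (.inl k))
      rw [hc k, Fintype.card_sum, Fintype.card_fin] at h3
      have := h k
      have := h l
      omega
    · have := hw _ hv
      simp [t] at this
  obtain ⟨f, hf, hft⟩ := (Finset.all_card_le_biUnion_card_iff_exists_injective t).1 hall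
  let p : I → Prop := fun k => ∃ l, f (.inl k) = .inl l
  let g : {k // p k} → I := fun k => k.2.choose
  have hg : ∀ k : {k // p k}, f (.inl k.1) = .inl (g k) := fun k => k.2.choose_spec
  have gi : Function.Injective g := by
    intro a b hab
    have : f (.inl a.1) = f (.inl b.1) := by rw [hg, hg, hab]
    exact Subtype.ext (Sum.inl_injective (hf this))
  let e : {k // p k} ≃ {l // l ∈ Set.range g} := Equiv.ofInjective g gi
  refine ⟨e.extendSubtype, ?_⟩
  have hnp : ∀ k : {k // bad k (e.extendSubtype k)}, ∃ j : Fin M, f (.inl k.1) = .inr j := by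
    rintro ⟨k, hk⟩
    by_contra hcon
    have hp : p k := by
      rcases hfk : f (.inl k) with l | j
      · exact ⟨l, hfk⟩
      · exact absurd ⟨j, hfk⟩ hcon
    rw [Equiv.extendSubtype_apply_of_mem e k hp] at hk
    have h1 := hft (.inl k)
    rw [hg ⟨k, hp⟩] at h1
    simp [t] at h1
    exact h1 hk
  choose j hj using hnp
  have ji : Function.Injective j := by
    intro a b hab
    have : f (.inl a.1) = f (.inl b.1) := by rw [hj, hj, hab]
    exact Subtype.ext (Sum.inl_injective (hf this))
  simpa using Nat.card_le_card_of_injective j ji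

lemma exists_approx {X : Type*} [MetricSpace X] [PolishSpace X] [MeasurableSpace X] [BorelSpace X]
    (ρ : Measure X) [IsProbabilityMeasure ρ] (ε : ℝ) (hε : 0 < ε) :
    ∃ (I : Type) (_ : Fintype I) (_ : Nonempty I) (x : I → X), ∀ B, MeasurableSet B →
      ρ B ≤ (Fintype.card I : ℝ≥0∞)⁻¹ * (∑ k, (thickening ε B).indicator 1 (x k)) + ENNReal.ofReal ε := by
  classical
  obtain ⟨A, Am, Ab, Ad, AU, Adj⟩ := SeparableSpace.exists_measurable_partition_diam_le (Ω := X) (half_pos hε)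
  have : Nonempty X := by
    by_contra hX
    rw [not_nonempty_iff] at hX
    have := measure_univ (μ := ρ)
    simp [Set.univ_eq_empty_iff.2 hX] at this
  have htend : Filter.Tendsto (fun m => ρ (⋃ i ∈ Finset.range m, A i)ᶜ) Filter.atTop (nhds 0) := by
    have h0 : (⋂ m, (⋃ i ∈ Finset.range m, A i)ᶜ) = ∅ := by
      rw [← Set.compl_iUnion, Set.compl_empty_iff, Set.eq_univ_iff_forall]
      intro x
      have hx : x ∈ ⋃ n, A n := AU ▸ Set.mem_univ x
      obtain ⟨n, hn⟩ := Set.mem_iUnion.1 hx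
      simp only [Set.mem_iUnion, Finset.mem_range]
      exact ⟨n + 1, n, by omega, hn⟩
    have := tendsto_measure_iInter_atTop (μ := ρ) (s := fun m => (⋃ i ∈ Finset.range m, A i)ᶜ)
      (fun m => (Finset.measurableSet_biUnion _ (fun i _ => Am i)).compl.nullMeasurableSet)
      (by
        intro a b hab
        apply Set.compl_subset_compl.2
        apply Set.biUnion_subset_biUnion_left
        intro i hi
        simp only [Finset.coe_range, Set.mem_Iio, Finset.mem_coe] at hi ⊢
        omega) ⟨0, measure_ne_top _ _⟩
    rwa [h0, measure_empty] at this
  obtain ⟨m, hm⟩ := (htend.eventually_lt_const (u := ENNReal.ofReal (ε/2)) (by simpa using hε)).exists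
  obtain ⟨N, hN⟩ := exists_nat_gt (2 * m / ε)
  have hN0 : 0 < N := by
    have : (0:ℝ) < N := lt_of_le_of_lt (by positivity) hN
    exact_mod_cast this
  have hN0' : (0:ℝ) < N := by exact_mod_cast hN0
  let n : ℕ → ℕ := fun i => ⌊N * ρ.real (A i)⌋₊
  have hn1 : ∀ i, ρ (A i) ≤ (N:ℝ≥0∞)⁻¹ * (n i) + (N:ℝ≥0∞)⁻¹ := by
    intro i
    have h1 := (Nat.lt_floor_add_one (N * ρ.real (A i))).le
    have h2 : ρ.real (A i) ≤ (N:ℝ)⁻¹ * (n i) + (N:ℝ)⁻¹ := by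
      have : (N:ℝ)⁻¹ * (n i) + (N:ℝ)⁻¹ = (n i + 1) / N := by field_simp
      rw [this, le_div_iff₀ hN0', mul_comm]
      exact h1
    rw [← ofReal_measureReal (μ := ρ) (s := A i)]
    refine (ENNReal.ofReal_le_ofReal h2).trans ?_
    rw [ENNReal.ofReal_add (by positivity) (by positivity), ENNReal.ofReal_mul (by positivity),
      ENNReal.ofReal_inv_of_pos hN0', ENNReal.ofReal_natCast, ENNReal.ofReal_natCast]
  have hnsum : ∑ i : Fin m, n i ≤ N := by
    have h1 : ∑ i : Fin m, ρ.real (A i) ≤ 1 := by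
      rw [← Finset.sum_range (fun i => ρ.real (A i)),
        ← measureReal_biUnion_finset (fun i _ j _ hij => Adj hij) (fun i _ => Am i)]
      exact measureReal_le_one
    have h2 : ((∑ i : Fin m, n i : ℕ) : ℝ) ≤ N := by
      push_cast
      calc ∑ i : Fin m, (n i : ℝ) ≤ ∑ i : Fin m, N * ρ.real (A i) :=
            Finset.sum_le_sum (fun i _ => Nat.floor_le (by positivity))
        _ = N * ∑ i : Fin m, ρ.real (A i) := by rw [Finset.mul_sum]
        _ ≤ N * 1 := by gcongr
        _ = N := mul_one _
    exact_mod_cast h2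
  let I : Type := (Σ i : Fin m, Fin (n i)) ⊕ Fin (N - ∑ i : Fin m, n i)
  have hcard : Fintype.card I = N := by
    simp [I]
    omega
  let y : ℕ → X := fun i => if h : (A i).Nonempty then h.some else Classical.arbitrary X
  have hy : ∀ i, (A i).Nonempty → y i ∈ A i := by
    intro i hi
    simp only [y, dif_pos hi]
    exact hi.some_mem
  refine ⟨I, inferInstance, Fintype.card_pos_iff.1 (hcard.symm ▸ hN0 : 0 < Fintype.card I), Sum.elim (fun s => y s.1) (fun _ => Classical.arbitrary X), ?_⟩
  intro B hB
  rw [hcard]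
  have hpiece : ∀ i, ρ (B ∩ A i) ≤ (N:ℝ≥0∞)⁻¹ * (n i * (thickening ε B).indicator (1 : X → ℝ≥0∞) (y i)) + (N:ℝ≥0∞)⁻¹ := by
    intro i
    by_cases hne : (B ∩ A i).Nonempty
    · obtain ⟨b, hb, hbA⟩ := hne
      have : y i ∈ thickening ε B := by
        rw [mem_thickening_iff]
        refine ⟨b, hb, ?_⟩
        have := dist_le_diam_of_mem (Ab i) (hy i ⟨b, hbA⟩) hbA
        linarith [Ad i]
      rw [Set.indicator_of_mem this]
      simp only [Pi.one_apply, mul_one]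
      exact (measure_mono Set.inter_subset_right).trans (hn1 i)
    · rw [Set.not_nonempty_iff_eq_empty.1 hne]
      simp
  have hmN : (m : ℝ≥0∞) * (N:ℝ≥0∞)⁻¹ ≤ ENNReal.ofReal (ε/2) := by
    have h1 : (m : ℝ) * (N:ℝ)⁻¹ ≤ ε / 2 := by
      rw [div_lt_iff₀ hε] at hN
      rw [← div_eq_mul_inv, div_le_iff₀ hN0']
      linarith
    have h2 := ENNReal.ofReal_le_ofReal h1
    rwa [ENNReal.ofReal_mul (by positivity),
      ENNReal.ofReal_inv_of_pos hN0', ENNReal.ofReal_natCast, ENNReal.ofReal_natCast] at h2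
  calc ρ B ≤ ρ ((⋃ i ∈ Finset.range m, B ∩ A i) ∪ (⋃ i ∈ Finset.range m, A i)ᶜ) := by
        apply measure_mono
        intro b hb
        by_cases h : b ∈ ⋃ i ∈ Finset.range m, A i
        · left
          simp only [Set.mem_iUnion] at h ⊢
          obtain ⟨i, hi, hbi⟩ := h
          exact ⟨i, hi, hb, hbi⟩
        · right; exact h
    _ ≤ (∑ i ∈ Finset.range m, ρ (B ∩ A i)) + ENNReal.ofReal (ε/2) :=
        (measure_union_le _ _).trans (add_le_add (measure_biUnion_finset_le _ _) hm.le)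
    _ ≤ (∑ i ∈ Finset.range m, ((N:ℝ≥0∞)⁻¹ * (n i * (thickening ε B).indicator (1 : X → ℝ≥0∞) (y i)) + (N:ℝ≥0∞)⁻¹)) + ENNReal.ofReal (ε/2) := by
        gcongr with i hi
        exact hpiece i
    _ = (N:ℝ≥0∞)⁻¹ * (∑ i : Fin m, (n i * (thickening ε B).indicator (1 : X → ℝ≥0∞) (y i))) + m * (N:ℝ≥0∞)⁻¹ + ENNReal.ofReal (ε/2) := by
        rw [Finset.sum_add_distrib, ← Finset.mul_sum, Finset.sum_range (fun i => ((n i : ℝ≥0∞) * (thickening ε B).indicator (1 : X → ℝ≥0∞) (y i)))]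
        simp
    _ ≤ _ := by
        rw [add_assoc]
        apply add_le_add
        · gcongr
          rw [Fintype.sum_sum_type, Fintype.sum_sigma]
          simp
        · calc _ ≤ ENNReal.ofReal (ε/2) + ENNReal.ofReal (ε/2) := by gcongr
            _ = _ := by rw [← ENNReal.ofReal_add (by positivity) (by positivity)]; simp

lemma exists_approx_coupling {X : Type*} [MetricSpace X] [PolishSpace X] [MeasurableSpace X]
    [BorelSpace X] (ρ : Measure X) [IsProbabilityMeasure ρ]
    (α : ℝ) (hκ : ∀ x : X, ρ (closedBall x α) ≤ 2⁻¹) (ε : ℝ) (hε : 0 < ε) :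
    ∃ lam : Measure (X × X), IsProbabilityMeasure lam ∧ lam.map Prod.fst = lam.map Prod.snd ∧
      levyProkhorovEDist ρ (lam.map Prod.fst) ≤ ENNReal.ofReal ε ∧
      lam {p : X × X | dist p.1 p.2 < α - 2 * ε} ≤ ENNReal.ofReal (4 * ε) := by
  classical
  obtain ⟨I, _, _, x, hx⟩ := exists_approx ρ ε hε
  set N := Fintype.card I with hNdef
  have hN0 : 0 < N := Fintype.card_pos
  have hN0' : (0:ℝ) < N := by exact_mod_cast hN0
  have hNe : (N:ℝ≥0∞) ≠ 0 := by exact_mod_cast hN0.ne'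
  have hNt : (N:ℝ≥0∞) ≠ ∞ := ENNReal.natCast_ne_top N
  let emp : ∀ {Y : Type _} [MeasurableSpace Y], (I → Y) → Measure Y :=
    fun z => (N:ℝ≥0∞)⁻¹ • ∑ k, Measure.dirac (z k)
  have emp_apply : ∀ {Y : Type _} [MeasurableSpace Y] (z : I → Y) {T : Set Y}, MeasurableSet T →
      emp z T = (N:ℝ≥0∞)⁻¹ * ∑ k, T.indicator 1 (z k) := by
    intro Y _ z T hT
    simp only [emp, Measure.smul_apply, smul_eq_mul, Measure.finsetSum_apply, Measure.dirac_apply' _ hT]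
  have emp_prob : ∀ {Y : Type _} [MeasurableSpace Y] (z : I → Y), IsProbabilityMeasure (emp z) := by
    intro Y _ z
    constructor
    rw [emp_apply z MeasurableSet.univ]
    simp only [Set.indicator_univ, Pi.one_apply, Finset.sum_const, Finset.card_univ, nsmul_eq_mul, mul_one]
    exact ENNReal.inv_mul_cancel hNe hNt
  have emp_map : ∀ (z : I → X × X) {f : X × X → X}, Measurable f →
      (emp z).map f = emp (fun k => f (z k)) := by
    intro z f hf
    ext T hT
    rw [Measure.map_apply hf hT, emp_apply z (hf hT), emp_apply _ hT]
    rfl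
  have emp_count : ∀ {Y : Type _} [MeasurableSpace Y] (z : I → Y) {T : Set Y}, MeasurableSet T →
      emp z T = (N:ℝ≥0∞)⁻¹ * (Nat.card {k // z k ∈ T} : ℝ≥0∞) := by
    intro Y _ z T hT
    rw [emp_apply z hT, Nat.card_eq_fintype_card, Fintype.card_subtype]
    simp [Set.indicator_apply]
  have := emp_prob x
  have hLP : levyProkhorovEDist ρ (emp x) ≤ ENNReal.ofReal ε := by
    apply levyProkhorovEDist_le_of_forall_le
    intro e B he het hB
    have hee : ε ≤ e.toReal := by
      rw [← ENNReal.ofReal_le_iff_le_toReal het.ne]; exact he.le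
    calc ρ B ≤ emp x (thickening ε B) + ENNReal.ofReal ε := by
          rw [emp_apply x isOpen_thickening.measurableSet]; exact hx B hB
      _ ≤ _ := add_le_add (measure_mono (thickening_mono hee B)) he.le
  have hLP2 : levyProkhorovEDist ρ (emp x) < ENNReal.ofReal (2 * ε) :=
    hLP.trans_lt ((ENNReal.ofReal_lt_ofReal_iff (by positivity)).2 (by linarith))
  let bad : I → I → Prop := fun k l => dist (x l) (x k) < α - 2 * ε
  have hbad : ∀ k, 2 * Nat.card {l // bad k l} ≤ N + ⌊4 * ε * N⌋₊ := by
    intro k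
    have h1 := right_measure_le_of_levyProkhorovEDist_lt hLP2
      (B := ball (x k) (α - 2 * ε)) measurableSet_ball
    have h2 : ρ (thickening (ENNReal.ofReal (2 * ε)).toReal (ball (x k) (α - 2 * ε))) ≤ 2⁻¹ := by
      refine (measure_mono ?_).trans (hκ (x k))
      rw [ENNReal.toReal_ofReal (by positivity)]
      refine (Metric.thickening_ball _ _ _).trans ?_
      rw [show 2 * ε + (α - 2 * ε) = α by ring]
      exact ball_subset_closedBall
    have h3 : (N:ℝ≥0∞)⁻¹ * (Nat.card {l // bad k l} : ℝ≥0∞) ≤ 2⁻¹ + ENNReal.ofReal (2 * ε) := by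
      have := emp_count x (T := ball (x k) (α - 2 * ε)) measurableSet_ball
      refine le_trans (le_of_eq this.symm) (h1.trans (add_le_add h2 le_rfl))
    have h4 : (N:ℝ)⁻¹ * (Nat.card {l // bad k l} : ℝ) ≤ 2⁻¹ + 2 * ε := by
      have := ENNReal.toReal_mono (ENNReal.add_ne_top.2 ⟨by simp, ENNReal.ofReal_ne_top⟩) h3
      rw [ENNReal.toReal_add (by simp) ENNReal.ofReal_ne_top, ENNReal.toReal_ofReal (by positivity)] at this
      simpa using this
    have h5 : (Nat.card {l // bad k l} : ℝ) ≤ N * (2⁻¹ + 2 * ε) := by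
      rwa [inv_mul_le_iff₀ hN0'] at h4
    have h6 : ((2 * Nat.card {l // bad k l} - N : ℕ) : ℝ) ≤ 4 * ε * N := by
      rcases le_total (2 * Nat.card {l // bad k l}) N with h | h
      · rw [Nat.sub_eq_zero_of_le h]; simp; positivity
      · rw [Nat.cast_sub h]; push_cast; linarith
    have := Nat.le_floor h6
    omega
  obtain ⟨σ, hσ⟩ := hall_perm bad (fun k l h => by simpa [bad, dist_comm] using h) _ hbad
  let z : I → X × X := fun k => (x (σ k), x k)
  have hz1 : (emp z).map Prod.fst = emp x := by
    rw [emp_map z measurable_fst]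
    ext T hT
    rw [emp_apply _ hT, emp_apply _ hT]
    congr 1
    exact Equiv.sum_comp σ (fun k => T.indicator (1 : X → ℝ≥0∞) (x k))
  have hz2 : (emp z).map Prod.snd = emp x := emp_map z measurable_snd
  refine ⟨emp z, emp_prob z, hz1.trans hz2.symm, by rw [hz1]; exact hLP, ?_⟩
  have hop : IsOpen {p : X × X | dist p.1 p.2 < α - 2 * ε} :=
    isOpen_lt continuous_dist continuous_const
  rw [emp_count z hop.measurableSet]
  have h7 : (Nat.card {k // bad k (σ k)} : ℝ) ≤ 4 * ε * N :=
    (Nat.cast_le.2 hσ).trans (Nat.floor_le (by positivity))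
  have h8 : (N:ℝ)⁻¹ * (Nat.card {k // bad k (σ k)} : ℝ) ≤ 4 * ε := by
    rw [inv_mul_le_iff₀ hN0']; linarith
  have h9 := ENNReal.ofReal_le_ofReal h8
  rwa [ENNReal.ofReal_mul (by positivity),
      ENNReal.ofReal_inv_of_pos hN0', ENNReal.ofReal_natCast, ENNReal.ofReal_natCast] at h9

lemma tight_of_tendsto {X : Type*} [TopologicalSpace X] [PolishSpace X] [MeasurableSpace X]
    [BorelSpace X] (μ : ℕ → ProbabilityMeasure X) (ρ : ProbabilityMeasure X)
    (h : Filter.Tendsto μ Filter.atTop (nhds ρ)) :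
    IsTightMeasureSet (Set.range fun n => (μ n : Measure X)) := by
  letI := TopologicalSpace.upgradeIsCompletelyMetrizable X
  have hc : IsCompact (closure (Set.range μ)) :=
    h.isCompact_insert_range.closure_of_subset (Set.subset_insert _ _)
  refine (isTightMeasureSet_of_isCompact_closure hc).subset ?_
  rintro _ ⟨n, rfl⟩
  exact ⟨μ n, ⟨n, rfl⟩, rfl⟩

theorem stmt7 {X : Type*} [MetricSpace X] [PolishSpace X] [MeasurableSpace X] [BorelSpace X]
    (ρ : Measure X) [IsProbabilityMeasure ρ]
    (α : ℝ) (hα : 0 < α)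
    (hκ : (⨆ x : X, ρ (closedBall x α)) ≤ 2⁻¹) :
    ∃ lam : Measure (X × X), IsProbabilityMeasure lam ∧
      lam.map Prod.fst = ρ ∧ lam.map Prod.snd = ρ ∧
      lam {p : X × X | dist p.1 p.2 < α} = 0 := by
  have hκ' : ∀ x : X, ρ (closedBall x α) ≤ 2⁻¹ := fun x => (le_iSup _ x).trans hκ
  let e : ℕ → ℝ := fun n => 1 / ((n : ℝ) + 1)
  have he0 : ∀ n, 0 < e n := fun n => Nat.one_div_pos_of_nat
  have he : Filter.Tendsto e Filter.atTop (nhds 0) := tendsto_one_div_add_atTop_nhds_zero_nat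
  choose L hLp hL1 hL2 hL3 using fun n => exists_approx_coupling ρ α hκ' (e n) (he0 n)
  let P : ProbabilityMeasure X := ⟨ρ, inferInstance⟩
  let Q : ℕ → ProbabilityMeasure (X × X) := fun n => ⟨L n, hLp n⟩
  let R : ℕ → ProbabilityMeasure X := fun n => (Q n).map continuous_fst.measurable.aemeasurable
  let R' : ℕ → ProbabilityMeasure X := fun n => (Q n).map continuous_snd.measurable.aemeasurable
  have hRR' : R = R' := by
    funext n
    exact Subtype.ext (hL1 n)
  have hR : Filter.Tendsto R Filter.atTop (nhds P) := by
    have h1 : Filter.Tendsto (fun n => LevyProkhorov.ofMeasure (R n)) Filter.atTop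
        (nhds (LevyProkhorov.ofMeasure P)) := by
      rw [tendsto_iff_edist_tendsto_0]
      refine tendsto_of_tendsto_of_tendsto_of_le_of_le (h := fun n => ENNReal.ofReal (e n))
        tendsto_const_nhds ?_ (fun _ => zero_le) ?_
      · simpa using ENNReal.tendsto_ofReal he
      · intro n
        simp only []
        rw [LevyProkhorov.edist_probabilityMeasure_def, levyProkhorovEDist_comm]
        exact hL2 n
    exact (LevyProkhorov.continuous_toMeasure_probabilityMeasure.tendsto _).comp h1
  have htR := tight_of_tendsto R P hR
  have htQ : IsTightMeasureSet {((μ : ProbabilityMeasure (X × X)) : Measure (X × X)) | μ ∈ Set.range Q} := by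
    apply IsTightMeasureSet.prodMk
    · refine htR.subset ?_
      rintro _ ⟨_, ⟨_, ⟨n, rfl⟩, rfl⟩, rfl⟩
      exact ⟨n, rfl⟩
    · refine htR.subset ?_
      rintro _ ⟨_, ⟨_, ⟨n, rfl⟩, rfl⟩, rfl⟩
      exact ⟨n, hL1 n⟩
  have hcomp := isCompact_closure_of_isTightMeasureSet htQ
  obtain ⟨lam, -, φ, hφ, hlim⟩ := hcomp.tendsto_subseq (x := Q) (fun n => subset_closure ⟨n, rfl⟩)
  have hfst : lam.map continuous_fst.measurable.aemeasurable = P :=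
    tendsto_nhds_unique
      (ProbabilityMeasure.tendsto_map_of_tendsto_of_continuous _ _ hlim continuous_fst)
      (hR.comp hφ.tendsto_atTop)
  have hsnd : lam.map continuous_snd.measurable.aemeasurable = P :=
    tendsto_nhds_unique
      (ProbabilityMeasure.tendsto_map_of_tendsto_of_continuous _ _ hlim continuous_snd)
      ((hRR' ▸ hR : Filter.Tendsto R' Filter.atTop (nhds P)).comp hφ.tendsto_atTop)
  refine ⟨lam, inferInstance, congrArg Subtype.val hfst, congrArg Subtype.val hsnd, ?_⟩
  have key : ∀ j : ℕ, (lam : Measure (X × X)) {p : X × X | dist p.1 p.2 < α - e j} = 0 := by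
    intro j
    have hop : IsOpen {p : X × X | dist p.1 p.2 < α - e j} :=
      isOpen_lt continuous_dist continuous_const
    have h1 := ProbabilityMeasure.le_liminf_measure_open_of_tendsto hlim hop
    have heφ : Filter.Tendsto (fun n => e (φ n)) Filter.atTop (nhds 0) := he.comp hφ.tendsto_atTop
    have h2 : Filter.Tendsto (fun n => ENNReal.ofReal (4 * e (φ n))) Filter.atTop (nhds 0) := by
      simpa using ENNReal.tendsto_ofReal (heφ.const_mul 4)
    have h3 : Filter.Tendsto (fun n => (Q (φ n) : Measure (X × X)) {p : X × X | dist p.1 p.2 < α - e j})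
        Filter.atTop (nhds 0) := by
      refine tendsto_of_tendsto_of_tendsto_of_le_of_le' tendsto_const_nhds h2
        (Filter.Eventually.of_forall fun _ => zero_le) ?_
      filter_upwards [heφ.eventually_lt_const (half_pos (he0 j))] with n hn
      refine (measure_mono ?_).trans (hL3 (φ n))
      intro p hp
      simp only [Set.mem_ofPred_eq] at hp ⊢
      linarith
    have h4 := h3.liminf_eq
    exact le_antisymm (h1.trans h4.le) (zero_le)
  refine measure_mono_null ?_ (measure_iUnion_null key)
  intro p hp
  simp only [Set.mem_ofPred_eq] at hp
  obtain ⟨j, hj⟩ := (he.eventually_lt_const (sub_pos.2 hp)).exists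
  refine Set.mem_iUnion.2 ⟨j, ?_⟩
  simp only [Set.mem_ofPred_eq]
  linarith
end

section
/- Let (X,d) be a Polish space, ρ a Borel probability measure on X, and h : [0,∞) → (0,∞] a strictly decreasing continuous function with inverse h^{-1}. Define 𝒞_∞(ρ) := inf over couplings λ of ρ with itself of the λ-essential supremum of h(d(x,y)). If 𝒞_∞(ρ) is finite and 𝒞_∞(ρ)/2 belongs to the range of h, then κ_ρ( h^{-1}( 𝒞_∞(ρ)/2 ) ) > 1/2, where κ_ρ(α) := sup_{x∈X} ρ(B̄(x,α)). -/
open MeasureTheory Metric ENNReal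

/-- Compatibility of labels; the dummy label is compatible with everything. -/
def labelRel (E : ℕ → ℕ → Prop) : Option ℕ → Option ℕ → Prop
  | some i, some j => E i j
  | _, _ => True

lemma labelRel_symm {E : ℕ → ℕ → Prop} (hs : ∀ i j, E i j → E j i) (a b : Option ℕ)
    (hab : labelRel E a b) : labelRel E b a := by
  cases a <;> cases b <;> simp_all [labelRel]

open Classical in
lemma exists_matching {L : Type} [Fintype L] (E : ℕ → ℕ → Prop) (hs : ∀ i j, E i j → E j i)
    (c : L → Option ℕ)
    (hc : ∀ l, 2 * (Finset.univ.filter (fun l' => ¬ labelRel E (c l) (c l'))).card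
      ≤ Fintype.card L) :
    ∃ f : L → L, Function.Injective f ∧ ∀ l, labelRel E (c l) (c (f l)) := by
  have key := (Finset.all_card_le_biUnion_card_iff_exists_injective
    (fun l : L => Finset.univ.filter (fun l' => labelRel E (c l) (c l')))).1 ?_
  · obtain ⟨f, hf, hf'⟩ := key
    exact ⟨f, hf, fun l => by simpa using hf' l⟩
  intro s
  rcases s.eq_empty_or_nonempty with rfl | ⟨l, hl⟩
  · simp
  by_cases hall : ∀ y, y ∈ s.biUnion
      (fun l : L => Finset.univ.filter (fun l' => labelRel E (c l) (c l')))
  · rw [Finset.eq_univ_iff_forall.2 hall]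
    exact Finset.card_le_univ s
  push Not at hall
  obtain ⟨y, hy⟩ := hall
  have h1 : s ⊆ Finset.univ.filter (fun l' => ¬ labelRel E (c y) (c l')) := by
    intro x hx
    simp only [Finset.mem_filter, Finset.mem_univ, true_and]
    intro hr
    apply hy
    simp only [Finset.mem_biUnion, Finset.mem_filter, Finset.mem_univ, true_and]
    exact ⟨x, hx, labelRel_symm hs _ _ hr⟩
  have h2 : Finset.univ.filter (fun l' => labelRel E (c l) (c l')) ⊆ s.biUnion
      (fun l : L => Finset.univ.filter (fun l' => labelRel E (c l) (c l'))) :=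
    Finset.subset_biUnion_of_mem
      (fun l : L => Finset.univ.filter (fun l' => labelRel E (c l) (c l'))) hl
  have h1' := Finset.card_le_card h1
  have h2' := Finset.card_le_card h2
  have h3 := hc l
  have h4 := hc y
  have h5 := Finset.card_filter_add_card_filter_not (s := (Finset.univ : Finset L))
    (fun l' => labelRel E (c l) (c l'))
  rw [Finset.card_univ] at h5
  omega

open Classical in
lemma exists_labels (p : ℕ → ℝ) (hp : ∀ i, 0 ≤ p i) (hsum : HasSum p 1) (n : ℕ) :
    ∃ (L : Type) (_ : Fintype L) (c : L → Option ℕ), Fintype.card L = n ∧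
      (∀ i, ((Finset.univ.filter (fun l => c l = some i)).card : ℝ) ≤ n * p i) ∧
      (∀ i < n, n * p i - 1 ≤ ((Finset.univ.filter (fun l => c l = some i)).card : ℝ)) := by
  set k : Fin n → ℕ := fun i => ⌊n * p i⌋₊ with hk
  have hM : ∑ i, k i ≤ n := by
    have h1 : ((∑ i, k i : ℕ) : ℝ) ≤ n := by
      push_cast
      calc ∑ i, (k i : ℝ) ≤ ∑ i : Fin n, n * p i :=
            Finset.sum_le_sum fun i _ => Nat.floor_le (mul_nonneg (by positivity) (hp _))
        _ = n * ∑ i ∈ Finset.range n, p i := by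
            rw [← Finset.mul_sum, Finset.sum_range]
        _ ≤ n * 1 := by
            gcongr
            exact sum_le_hasSum _ (fun i _ => hp i) hsum
        _ = n := mul_one _
    exact_mod_cast h1
  let c : ((Σ i : Fin n, Fin (k i)) ⊕ Fin (n - ∑ i, k i)) → Option ℕ :=
    Sum.elim (fun s => some (s.1 : ℕ)) (fun _ => none)
  have hcnt : ∀ i : Fin n, (Finset.univ.filter (fun l => c l = some (i : ℕ))).card = k i := by
    intro i
    have : Finset.univ.filter (fun l => c l = some (i : ℕ)) =
        (Finset.univ : Finset (Fin (k i))).map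
          ⟨fun a => Sum.inl ⟨i, a⟩, fun a b hab => by simpa using hab⟩ := by
      ext l
      rcases l with ⟨j, a⟩ | l
      · simp only [c, Finset.mem_filter, Finset.mem_univ, true_and, Sum.elim_inl,
          Option.some.injEq, Finset.mem_map]
        constructor
        · intro hh
          obtain rfl := Fin.ext hh
          exact ⟨a, rfl⟩
        · rintro ⟨b, hb⟩
          have hb' : (⟨i, b⟩ : Σ i : Fin n, Fin (k i)) = ⟨j, a⟩ := Sum.inl.inj hb
          have hb2 : i = j := congrArg Sigma.fst hb'
          rw [hb2]
      · simp [c]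
    rw [this]; simp
  refine ⟨_, inferInstance, c, ?_, ?_, ?_⟩
  · simp; omega
  · intro i
    by_cases hi : i < n
    · have := hcnt ⟨i, hi⟩
      simp only at this
      rw [this]
      exact Nat.floor_le (mul_nonneg (by positivity) (hp _))
    · have : Finset.univ.filter (fun l => c l = some i) = ∅ := by
        ext l
        rcases l with ⟨j, a⟩ | l
        · have := j.2
          simp [c]; omega
        · simp [c]
      rw [this]
      simpa using mul_nonneg (Nat.cast_nonneg n) (hp i)
  · intro i hi
    have := hcnt ⟨i, hi⟩
    simp only at this
    rw [this]
    exact (Nat.sub_one_lt_floor _).le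

open Classical in
lemma level_matrix (p : ℕ → ℝ) (hp : ∀ i, 0 ≤ p i) (hsum : HasSum p 1)
    (E : ℕ → ℕ → Prop) (hs : ∀ i j, E i j → E j i)
    (hE : ∀ i, ∀ F : Finset ℕ, (∀ j ∈ F, ¬ E i j) → ∑ j ∈ F, p j ≤ 1 / 2) (n : ℕ) (hn : 0 < n) :
    ∃ q : ℕ → ℕ → ℝ, (∀ i j, 0 ≤ q i j) ∧ (∀ i j, ¬ E i j → q i j = 0) ∧
      (∀ i (F : Finset ℕ), ∑ j ∈ F, q i j ≤ p i) ∧ (∀ j (F : Finset ℕ), ∑ i ∈ F, q i j ≤ p j) ∧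
      ∀ m ≤ n, 2 * ∑ i ∈ Finset.range m, p i - 1 - 2 * m / n ≤
        ∑ i ∈ Finset.range m, ∑ j ∈ Finset.range m, q i j := by
  obtain ⟨L, _, c, hL, hc1, hc2⟩ := exists_labels p hp hsum n
  have hn' : (0 : ℝ) < n := by exact_mod_cast hn
  obtain ⟨f, hf, hfR⟩ := exists_matching E hs c (by
    intro l
    rw [hL]
    rcases hcl : c l with _ | i
    · simp [labelRel]
    set F : Finset ℕ := (Finset.eraseNone (Finset.univ.image c)).filter (fun j => ¬ E i j) with hF
    have hsub : Finset.univ.filter (fun l' => ¬ labelRel E (some i) (c l')) ⊆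
        F.biUnion (fun j => Finset.univ.filter (fun l => c l = some j)) := by
      intro l' hl'
      have hl2 := (Finset.mem_filter.1 hl').2
      rcases hcl' : c l' with _ | j
      · rw [hcl'] at hl2
        exact absurd trivial hl2
      · rw [hcl'] at hl2
        simp only [Finset.mem_biUnion, Finset.mem_filter, hF, Finset.mem_eraseNone,
          Finset.mem_image, Finset.mem_univ, true_and]
        exact ⟨j, ⟨⟨l', hcl'⟩, hl2⟩, hcl'⟩
    have h1 : ((Finset.univ.filter (fun l' => ¬ labelRel E (some i) (c l'))).card : ℝ)
        ≤ n * (1 / 2) := by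
      calc ((Finset.univ.filter (fun l' => ¬ labelRel E (some i) (c l'))).card : ℝ)
          ≤ ((∑ j ∈ F, (Finset.univ.filter (fun l => c l = some j)).card : ℕ) : ℝ) := by
            exact_mod_cast (Finset.card_le_card hsub).trans Finset.card_biUnion_le
        _ ≤ ∑ j ∈ F, n * p j := by
            push_cast
            exact Finset.sum_le_sum fun j _ => hc1 j
        _ = n * ∑ j ∈ F, p j := by rw [Finset.mul_sum]
        _ ≤ n * (1 / 2) := by
            gcongr
            exact hE i F (fun j hj => (Finset.mem_filter.1 hj).2)
    have h2 : (2 : ℝ) * ((Finset.univ.filter (fun l' => ¬ labelRel E (some i) (c l'))).card : ℝ)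
      ≤ n := by linarith
    exact_mod_cast h2)
  have hsumcard : ∀ (g : L → Option ℕ) (s : Finset L) (F : Finset ℕ),
      ∑ j ∈ F, (s.filter (fun l => g l = some j)).card =
        (s.filter (fun l => ∃ j ∈ F, g l = some j)).card := by
    intro g s F
    rw [← Finset.card_biUnion]
    · congr 1
      ext l
      simp only [Finset.mem_biUnion, Finset.mem_filter]
      tauto
    · intro a _ b _ hab
      rw [Function.onFun, Finset.disjoint_left]
      intro l h1 h2
      simp only [Finset.mem_filter] at h1 h2
      rw [h1.2] at h2
      exact hab (by simpa using h2.2)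
  refine ⟨fun i j => ((Finset.univ.filter (fun l => c l = some i)).filter
      (fun l => c (f l) = some j)).card / n, ?_, ?_, ?_, ?_, ?_⟩
  · intro i j; positivity
  · intro i j hij
    have : ((Finset.univ.filter (fun l => c l = some i)).filter
      (fun l => c (f l) = some j)) = ∅ := by
      ext l
      simp only [Finset.mem_filter, Finset.mem_univ, true_and, Finset.notMem_empty, iff_false]
      rintro ⟨h1, h2⟩
      have := hfR l
      rw [h1, h2] at this
      exact hij this
    simp only [this]; simp
  · intro i F
    rw [← Finset.sum_div, div_le_iff₀ hn', mul_comm]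
    refine le_trans ?_ (hc1 i)
    have := hsumcard (fun l => c (f l)) (Finset.univ.filter (fun l => c l = some i)) F
    have h2 := Finset.card_filter_le (Finset.univ.filter (fun l => c l = some i))
      (fun l => ∃ j ∈ F, c (f l) = some j)
    rw [← this] at h2
    exact_mod_cast h2
  · intro j F
    rw [← Finset.sum_div, div_le_iff₀ hn', mul_comm]
    refine le_trans ?_ (hc1 j)
    have := hsumcard c (Finset.univ.filter (fun l => c (f l) = some j)) F
    have h2 := Finset.card_filter_le (Finset.univ.filter (fun l => c (f l) = some j))
      (fun l => ∃ j ∈ F, c l = some j)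
    rw [← this] at h2
    have h3 : (Finset.univ.filter (fun l => c (f l) = some j)).card ≤
        (Finset.univ.filter (fun l => c l = some j)).card :=
      Finset.card_le_card_of_injOn f (by intro l hl; simpa using hl) hf.injOn
    simp_rw [Finset.filter_comm (fun l => c l = some _)]
    exact_mod_cast h2.trans h3
  · intro m hm
    simp_rw [← Finset.sum_div]
    rw [le_div_iff₀ hn']
    have e1 : ∑ i ∈ Finset.range m, ∑ j ∈ Finset.range m,
        ((Finset.univ.filter (fun l => c l = some i)).filter (fun l => c (f l) = some j)).card
        = (Finset.univ.filter (fun l => (∃ i ∈ Finset.range m, c l = some i) ∧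
          (∃ i ∈ Finset.range m, c (f l) = some i))).card := by
      simp_rw [hsumcard (fun l => c (f l))]
      simp_rw [Finset.filter_comm (fun l => c l = some _)]
      rw [hsumcard c, Finset.filter_comm, Finset.filter_filter]
    have e2 := hsumcard c Finset.univ (Finset.range m)
    have hbij : Function.Bijective f := Finite.injective_iff_bijective.1 hf
    have e3 : (Finset.univ.filter (fun l => (∃ i ∈ Finset.range m, c (f l) = some i))).card
        = (Finset.univ.filter (fun l => (∃ i ∈ Finset.range m, c l = some i))).card := by
      refine Finset.card_bij (fun l _ => f l) (by intro l hl; simpa using hl)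
        (fun a _ b _ h => hf h) ?_
      intro b hb
      obtain ⟨a, rfl⟩ := hbij.2 b
      exact ⟨a, by simpa using hb, rfl⟩
    have e4 := Finset.card_union_add_card_inter
      (Finset.univ.filter (fun l => (∃ i ∈ Finset.range m, c l = some i)))
      (Finset.univ.filter (fun l => (∃ i ∈ Finset.range m, c (f l) = some i)))
    rw [← Finset.filter_and] at e4
    have e5 := Finset.card_le_univ
      ((Finset.univ.filter (fun l => (∃ i ∈ Finset.range m, c l = some i))) ∪
      (Finset.univ.filter (fun l => (∃ i ∈ Finset.range m, c (f l) = some i))))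
    rw [hL] at e5
    have e6 : n * ∑ i ∈ Finset.range m, p i - m ≤
        ((∑ i ∈ Finset.range m, (Finset.univ.filter (fun l => c l = some i)).card : ℕ) : ℝ) := by
      push_cast
      rw [Finset.mul_sum]
      calc _ = ∑ i ∈ Finset.range m, (n * p i - 1) := by simp
        _ ≤ _ := Finset.sum_le_sum fun i hi => hc2 i (by rw [Finset.mem_range] at hi; omega)
    have e7 : (2 * ∑ i ∈ Finset.range m, p i - 1 - 2 * m / n) * (n : ℝ)
        = 2 * (n * ∑ i ∈ Finset.range m, p i - m) - n := by
      field_simp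
      ring
    rw [e7]
    have e8 : 2 * (∑ i ∈ Finset.range m, (Finset.univ.filter (fun l => c l = some i)).card) ≤
      n + ∑ i ∈ Finset.range m, ∑ j ∈ Finset.range m,
        ((Finset.univ.filter (fun l => c l = some i)).filter
          (fun l => c (f l) = some j)).card := by
      rw [e1, e2]; omega
    have e9 : (2 : ℝ) * ((∑ i ∈ Finset.range m,
      (Finset.univ.filter (fun l => c l = some i)).card : ℕ) : ℝ) ≤
      n + ((∑ i ∈ Finset.range m, ∑ j ∈ Finset.range m,
        ((Finset.univ.filter (fun l => c l = some i)).filter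
          (fun l => c (f l) = some j)).card : ℕ) : ℝ) := by exact_mod_cast e8
    push_cast at e9 e6 ⊢
    linarith

open Filter Topology in
lemma rows_hasSum (p : ℕ → ℝ) (hsum : HasSum p 1) (q : ℕ → ℕ → ℝ)
    (hq : ∀ i j, 0 ≤ q i j) (hrow : ∀ i (F : Finset ℕ), ∑ j ∈ F, q i j ≤ p i)
    (htot : ∀ m, 2 * ∑ i ∈ Finset.range m, p i - 1 ≤
        ∑ i ∈ Finset.range m, ∑ j ∈ Finset.range m, q i j) (i : ℕ) : HasSum (q i) (p i) := by
  have hS : ∀ i, Summable (q i) := fun i => summable_of_sum_le (hq i) (hrow i)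
  have hle : ∀ i, ∑' j, q i j ≤ p i := fun i => (hS i).tsum_le_of_sum_le (hrow i)
  have hge : p i ≤ ∑' j, q i j := by
    have hlim : Tendsto (fun m => p i + ∑ i ∈ Finset.range m, p i - 1) atTop (𝓝 (p i + 1 - 1)) :=
      (hsum.tendsto_sum_nat.const_add _).sub_const _
    rw [add_sub_cancel_right] at hlim
    refine le_of_tendsto hlim ?_
    filter_upwards [eventually_gt_atTop i] with m hm
    have hm' : i ∈ Finset.range m := Finset.mem_range.2 hm
    have h1 : ∑ i ∈ Finset.range m, ∑ j ∈ Finset.range m, q i j ≤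
        ∑ i ∈ Finset.range m, ∑' j, q i j :=
      Finset.sum_le_sum fun i _ => (hS i).sum_le_tsum _ (fun j _ => hq i j)
    have h2 : ∑ i ∈ (Finset.range m).erase i, ∑' j, q i j ≤ ∑ i ∈ (Finset.range m).erase i, p i :=
      Finset.sum_le_sum fun i _ => hle i
    have h3 := Finset.add_sum_erase (Finset.range m) (fun i => ∑' j, q i j) hm'
    have h4 := Finset.add_sum_erase (Finset.range m) p hm'
    have h5 := htot m
    linarith
  rw [le_antisymm hge (hle i)]
  exact (hS i).hasSum

open Filter Topology in
lemma exists_matrix (p : ℕ → ℝ) (hp : ∀ i, 0 ≤ p i) (hsum : HasSum p 1)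
    (E : ℕ → ℕ → Prop) (hs : ∀ i j, E i j → E j i)
    (hE : ∀ i, ∀ F : Finset ℕ, (∀ j ∈ F, ¬ E i j) → ∑ j ∈ F, p j ≤ 1 / 2) :
    ∃ q : ℕ → ℕ → ℝ, (∀ i j, 0 ≤ q i j) ∧ (∀ i j, ¬ E i j → q i j = 0) ∧
      (∀ i, HasSum (q i) (p i)) ∧ (∀ j, HasSum (fun i => q i j) (p j)) := by
  choose Q h0 hz hr hc ht using fun n : ℕ => level_matrix p hp hsum E hs hE (n + 1) n.succ_pos
  have hK : IsCompact (Set.univ.pi fun i : ℕ => Set.univ.pi fun _ : ℕ => Set.Icc 0 (p i)) :=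
    isCompact_univ_pi fun i => isCompact_univ_pi fun _ => isCompact_Icc
  obtain ⟨q, -, φ, hφ, hlim⟩ := hK.tendsto_subseq (x := Q) (by
    intro n i _ j _
    exact ⟨h0 n i j, by simpa using hr n i {j}⟩)
  have hl : ∀ i j, Tendsto (fun n => Q (φ n) i j) atTop (𝓝 (q i j)) := by
    intro i j
    have := tendsto_pi_nhds.1 (tendsto_pi_nhds.1 hlim i) j
    exact this
  have q0 : ∀ i j, 0 ≤ q i j := fun i j => ge_of_tendsto' (hl i j) fun n => h0 _ _ _
  have qr : ∀ i (F : Finset ℕ), ∑ j ∈ F, q i j ≤ p i := fun i F =>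
    le_of_tendsto' (tendsto_finsetSum F fun j _ => hl i j) fun n => hr _ _ _
  have qc : ∀ j (F : Finset ℕ), ∑ i ∈ F, q i j ≤ p j := fun j F =>
    le_of_tendsto' (tendsto_finsetSum F fun i _ => hl i j) fun n => hc _ _ _
  have qt : ∀ m, 2 * ∑ i ∈ Finset.range m, p i - 1 ≤
        ∑ i ∈ Finset.range m, ∑ j ∈ Finset.range m, q i j := by
    intro m
    have h1 : Tendsto (fun n : ℕ => (2 * m : ℝ) / ((n + 1 : ℕ) : ℝ)) atTop (𝓝 0) :=
      (tendsto_const_div_atTop_nhds_zero_nat (2 * m : ℝ)).comp (tendsto_add_atTop_nat 1)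
    have h2 := (h1.comp hφ.tendsto_atTop).const_sub (2 * ∑ i ∈ Finset.range m, p i - 1)
    rw [sub_zero] at h2
    refine le_of_tendsto_of_tendsto h2
      (tendsto_finsetSum _ fun i _ => tendsto_finsetSum _ fun j _ => hl i j) ?_
    filter_upwards [eventually_ge_atTop m] with n hn
    exact ht (φ n) m ((hn.trans (hφ.id_le n)).trans (Nat.le_succ _))
  refine ⟨q, q0, ?_, rows_hasSum p hsum q q0 qr qt,
    rows_hasSum p hsum (fun j i => q i j) (fun j i => q0 i j) qc fun m => ?_⟩
  · intro i j hij
    refine tendsto_nhds_unique (hl i j) ?_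
    simp only [hz _ i j hij]
    exact tendsto_const_nhds
  · rw [Finset.sum_comm]
    exact qt m

theorem stmt8 {X : Type*} [MetricSpace X] [PolishSpace X] [MeasurableSpace X] [BorelSpace X]
    (ρ : Measure X) [IsProbabilityMeasure ρ]
    (h : ℝ → ℝ≥0∞)
    (hpos : ∀ t : ℝ, 0 ≤ t → 0 < h t)
    (hanti : StrictAntiOn h (Set.Ici 0))
    (hcont : ContinuousOn h (Set.Ici 0))
    (Cinf : ℝ≥0∞)
    (hCinf : Cinf = ⨅ (lam : Measure (X × X))
        (_ : IsProbabilityMeasure lam ∧ lam.map Prod.fst = ρ ∧ lam.map Prod.snd = ρ),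
        essSup (fun p : X × X => h (dist p.1 p.2)) lam)
    (hfin : Cinf ≠ ⊤)
    (α : ℝ) (hα : 0 ≤ α)
    (hinv : h α = Cinf / 2) :
    (2 : ℝ≥0∞)⁻¹ < ⨆ x : X, ρ (closedBall x α) := by
  by_contra hcon
  rw [not_lt] at hcon
  have hball : ∀ x, ρ (closedBall x α) ≤ 2⁻¹ := fun x => (le_iSup _ x).trans hcon
  have hC0 : Cinf ≠ 0 := by
    rintro rfl
    have := hpos α hα
    simp [hinv] at this
  have hlt : h α < Cinf := by rw [hinv]; exact ENNReal.half_lt_self hC0 hfin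
  -- any coupling living on `β ≤ dist` bounds the infimum
  have hbound : ∀ β, 0 ≤ β → ∀ lam : Measure (X × X), IsProbabilityMeasure lam →
      lam.map Prod.fst = ρ → lam.map Prod.snd = ρ → (∀ᵐ z ∂lam, β ≤ dist z.1 z.2) →
      Cinf ≤ h β := by
    intro β hβ lam h1 h2 h3 h4
    rw [hCinf]
    refine (iInf₂_le lam ⟨h1, h2, h3⟩).trans ?_
    refine essSup_le_of_ae_le _ ?_
    filter_upwards [h4] with z hz
    exact hanti.antitoneOn hβ (hβ.trans hz) hz
  rcases hα.eq_or_lt with rfl | hα'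
  · refine absurd (hbound 0 le_rfl (ρ.prod ρ) inferInstance ?_ ?_ ?_) (not_le.2 hlt)
    · simp
    · simp
    · exact Filter.Eventually.of_forall fun z => dist_nonneg
  obtain ⟨β, hβ0, hβα, hβ⟩ : ∃ β, 0 ≤ β ∧ β < α ∧ h β < Cinf := by
    have hc : ContinuousAt h α := hcont.continuousAt (Ici_mem_nhds hα')
    have h1 := hc.eventually_lt_const hlt
    have h2 : ∀ᶠ t in nhdsWithin α (Set.Iio α), h t < Cinf := h1.filter_mono nhdsWithin_le_nhds
    have h3 : ∀ᶠ t in nhdsWithin α (Set.Iio α), 0 < t :=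
      (eventually_gt_nhds hα').filter_mono nhdsWithin_le_nhds
    obtain ⟨t, ht, ht', ht''⟩ := (h2.and (h3.and self_mem_nhdsWithin)).exists
    exact ⟨t, ht'.le, ht'', ht⟩
  refine absurd ?_ (not_le.2 hβ)
  set ε : ℝ := (α - β) / 3 with hε
  have hε0 : 0 < ε := by rw [hε]; linarith
  have : Nonempty X := ρ.nonempty_of_neZero
  classical
  let z : ℕ → X := TopologicalSpace.denseSeq X
  have hz : ∀ x, ∃ n, dist x (z n) < ε := fun x => by
    exact (TopologicalSpace.denseRange_denseSeq X).exists_dist_lt x hε0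
  let idx : X → ℕ := fun x => Nat.find (hz x)
  have hidx : ∀ x, dist x (z (idx x)) < ε := fun x => Nat.find_spec (hz x)
  have hm : Measurable idx := measurable_find hz fun n =>
    measurableSet_lt (measurable_id.dist measurable_const) measurable_const
  let ν : Measure ℕ := ρ.map idx
  have : IsProbabilityMeasure ν := Measure.isProbabilityMeasure_map hm.aemeasurable
  have hνs : ∑' i, ν {i} = 1 := by
    have := Measure.tsum_indicator_apply_singleton ν Set.univ MeasurableSet.univ
    simpa using this
  let p : ℕ → ℝ := fun i => ν.real {i}
  have hpν : ∀ i, ENNReal.ofReal (p i) = ν {i} := fun i => ofReal_measureReal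
  have hp : ∀ i, 0 ≤ p i := fun i => measureReal_nonneg
  have hsum : HasSum p 1 := by
    have h1 := ENNReal.hasSum_toReal (f := fun i => ν {i}) (by rw [hνs]; simp)
    rw [← ENNReal.tsum_toReal_eq (fun i => measure_ne_top _ _), hνs] at h1
    rw [ENNReal.toReal_one] at h1
    exact h1
  obtain ⟨q, q0, qz, qr, qc⟩ := exists_matrix p hp hsum
    (fun i j => β + 2 * ε ≤ dist (z i) (z j)) (fun i j hij => by rwa [dist_comm]) (by
      intro i F hF
      have h1 : ∑ j ∈ F, p j = ν.real F := by
        simp [p]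
      rw [h1]
      have h2 : ν F ≤ 2⁻¹ := by
        rw [Measure.map_apply hm F.measurableSet]
        refine (measure_mono ?_).trans (hball (z i))
        intro x hx
        have h3 := hF _ hx
        have h4 := hidx x
        have h5 := dist_triangle x (z (idx x)) (z i)
        rw [dist_comm (z (idx x))] at h5
        rw [mem_closedBall]
        simp only [not_le] at h3
        linarith
      have h3 := ENNReal.toReal_mono (by simp) h2
      simpa [Measure.real] using h3)
  let w : ℕ × ℕ → ℝ≥0∞ := fun a => ENNReal.ofReal (q a.1 a.2) / (ν {a.1} * ν {a.2})
  have hwm : Measurable fun a : X × X => w (idx a.1, idx a.2) :=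
    (measurable_of_countable w).comp
      ((hm.comp measurable_fst).prodMk (hm.comp measurable_snd))
  let lam : Measure (X × X) := (ρ.prod ρ).withDensity fun a => w (idx a.1, idx a.2)
  have hpos' : ∀ᵐ x ∂ρ, ν {idx x} ≠ 0 := by
    have : ∀ᵐ i ∂ν, ν {i} ≠ 0 := by
      rw [ae_iff_of_countable]
      exact fun i hi => hi
    exact ae_of_ae_map hm.aemeasurable this
  -- general marginal computation
  have hmarg : ∀ r : ℕ → ℝ, (∀ j, 0 ≤ r j) → ∀ i, (∀ j, r j ≤ p j) → HasSum r (p i) → ν {i} ≠ 0 →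
      ∫⁻ y, ENNReal.ofReal (r (idx y)) / (ν {i} * ν {idx y}) ∂ρ = 1 := by
    intro r hr i hrp hrs hi
    have h1 : ∫⁻ y, ENNReal.ofReal (r (idx y)) / (ν {i} * ν {idx y}) ∂ρ =
        ∫⁻ j, ENNReal.ofReal (r j) / (ν {i} * ν {j}) ∂ν :=
      (lintegral_map (f := fun j => ENNReal.ofReal (r j) / (ν {i} * ν {j}))
        (measurable_of_countable _) hm).symm
    rw [h1, lintegral_countable']
    have h2 : ∀ j, ENNReal.ofReal (r j) / (ν {i} * ν {j}) * ν {j} =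
        ENNReal.ofReal (r j) * (ν {i})⁻¹ := by
      intro j
      by_cases hj : ν {j} = 0
      · have : r j = 0 := le_antisymm ((hrp j).trans (by simp [p, Measure.real, hj])) (hr j)
        simp [this]
      · rw [div_eq_mul_inv, ENNReal.mul_inv (Or.inl hi) (Or.inr hj), mul_assoc, mul_assoc,
          ENNReal.inv_mul_cancel hj (measure_ne_top _ _), mul_one]
    simp_rw [h2]
    rw [ENNReal.tsum_mul_right, ← ENNReal.ofReal_tsum_of_nonneg hr hrs.summable, hrs.tsum_eq, hpν,
      ENNReal.mul_inv_cancel hi (measure_ne_top _ _)]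
  have hfst : lam.map Prod.fst = ρ := by
    ext A hA
    rw [Measure.map_apply measurable_fst hA, withDensity_apply _ (measurable_fst hA),
      show Prod.fst ⁻¹' A = A ×ˢ (Set.univ : Set X) by ext; simp,
      setLIntegral_prod _ hwm.aemeasurable]
    rw [Measure.restrict_univ]
    rw [← setLIntegral_one]
    refine lintegral_congr_ae (ae_restrict_of_ae ?_)
    filter_upwards [hpos'] with x hx
    exact hmarg (q (idx x)) (q0 _) (idx x)
      (fun j => le_hasSum (qc j) (idx x) fun i _ => q0 i j) (qr _) hx
  have hsnd : lam.map Prod.snd = ρ := by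
    ext A hA
    rw [Measure.map_apply measurable_snd hA, withDensity_apply _ (measurable_snd hA),
      show Prod.snd ⁻¹' A = (Set.univ : Set X) ×ˢ A by ext; simp,
      ← Measure.prod_restrict, lintegral_prod_symm _ hwm.aemeasurable]
    rw [Measure.restrict_univ]
    rw [← setLIntegral_one]
    refine lintegral_congr_ae (ae_restrict_of_ae ?_)
    filter_upwards [hpos'] with x hx
    have := hmarg (fun i => q i (idx x)) (fun i => q0 _ _) (idx x)
      (fun j => le_hasSum (qr j) (idx x) fun i _ => q0 j i) (qc _) hx
    simpa only [w, mul_comm] using this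
  refine hbound β hβ0 lam ⟨?_⟩ hfst hsnd ?_
  · have : lam.map Prod.fst Set.univ = 1 := by rw [hfst]; simp
    rwa [Measure.map_apply measurable_fst MeasurableSet.univ, Set.preimage_univ] at this
  · rw [ae_withDensity_iff hwm]
    refine Filter.Eventually.of_forall fun a ha => ?_
    have h1 : β + 2 * ε ≤ dist (z (idx a.1)) (z (idx a.2)) := by
      by_contra hh
      exact ha (by simp [w, qz _ _ hh])
    have h2 := hidx a.1
    have h3 := hidx a.2
    have h4 := dist_triangle4 (z (idx a.1)) a.1 a.2 (z (idx a.2))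
    rw [dist_comm (z (idx a.1)) a.1] at h4
    linarith
end

section
/- Let ρ be an absolutely continuous Borel probability measure on ℝ^d whose density has the form ρ(x) = K e^{−g(|x|)}, where K > 0 is a normalization constant and g : [0,∞) → [0,∞) is a nonnegative, increasing, convex function. Then for the Coulomb cost h(t) = 1/t: 𝒞(ρ) ≥ (1/4) · 𝒞_∞(ρ), where 𝒞(ρ) := inf over couplings λ of ρ with itself of ∫ 1/|x−y| dλ and 𝒞_∞(ρ) := inf over couplings λ of the λ-essential supremum of 1/|x−y|. -/
open MeasureTheory Metric ENNReal

lemma aux_median (f : ℝ → ℝ) (hfi : IntegrableOn f (Set.Ioi 0))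
    (h1 : ∫ r in Set.Ioi (0:ℝ), f r = 1) :
    ∃ m : ℝ, 0 < m ∧ ∫ r in Set.Ioi m, f r = 1 / 2 ∧ ∫ r in Set.Ioc 0 m, f r = 1 / 2 := by
  set F : ℝ → ℝ := (Set.Ioi (0:ℝ)).indicator f with hF
  have hFi : Integrable F := (integrable_indicator_iff measurableSet_Ioi).2 hfi
  have hc : Continuous fun t => ∫ r in (0:ℝ)..t, F r :=
    intervalIntegral.continuous_primitive (fun a b => hFi.intervalIntegrable) 0
  have hFe : ∫ r in Set.Ioi (0:ℝ), F r = 1 := by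
    rw [← h1]
    exact setIntegral_congr_fun measurableSet_Ioi (fun x hx => Set.indicator_of_mem hx f)
  have ht := intervalIntegral_tendsto_integral_Ioi (0:ℝ) hFi.integrableOn Filter.tendsto_id
  rw [hFe] at ht
  have hev := (ht.eventually (lt_mem_nhds (show (1/2:ℝ) < 1 by norm_num))).and
    (Filter.eventually_ge_atTop (0:ℝ))
  obtain ⟨T, hT, hT0⟩ := hev.exists
  have hmem : (1/2:ℝ) ∈ Set.Icc (∫ r in (0:ℝ)..0, F r) (∫ r in (0:ℝ)..T, F r) := by
    constructor
    · simp
    · exact hT.le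
  obtain ⟨m, hm, hme⟩ := intermediate_value_Icc hT0 hc.continuousOn hmem
  have hm0 : 0 < m := by
    rcases hm.1.lt_or_eq with h | h
    · exact h
    · exfalso
      rw [← h] at hme
      simp at hme
  have e2 : ∫ r in Set.Ioc 0 m, f r = 1 / 2 := by
    rw [← hme]
    simp only
    rw [intervalIntegral.integral_of_le hm0.le]
    exact setIntegral_congr_fun measurableSet_Ioc
      (fun x hx => (Set.indicator_of_mem (show x ∈ Set.Ioi (0:ℝ) from hx.1) f).symm)
  refine ⟨m, hm0, ?_, e2⟩
  have := setIntegral_union (f := f) (μ := volume) (Set.Ioc_disjoint_Ioi (le_refl m) (a := (0:ℝ)))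
    measurableSet_Ioi (hfi.mono_set Set.Ioc_subset_Ioi_self)
    (hfi.mono_set (Set.Ioi_subset_Ioi hm0.le))
  rw [Set.Ioc_union_Ioi_eq_Ioi hm0.le, h1, e2] at this
  linarith

lemma aux_mean (f : ℝ → ℝ) (hfi : IntegrableOn f (Set.Ioi 0))
    (h1 : ∫ r in Set.Ioi (0:ℝ), f r = 1) (hpos : ∀ r, 0 < r → 0 < f r)
    (m : ℝ) (hm : 0 < m)
    (hq : ∀ r s, 0 < r → r ≤ s → f r * f (s + m) ≤ f (r + m) * f s)
    (h2 : ∫ r in Set.Ioi m, f r = 1 / 2) (h3 : ∫ r in Set.Ioc 0 m, f r = 1 / 2)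
    (M : ℝ) (hM : 0 < M) :
    ∫ r in Set.Ioi (0:ℝ), min r M * f r ≤ 2 * m := by
  set a := ∫ r in Set.Ioi (0:ℝ), min r M * f r with ha
  by_cases ha0 : a ≤ 0
  · linarith
  push Not at ha0
  have hmp := measurePreserving_add_right (volume : Measure ℝ) m
  have hme := (MeasurableEquiv.addRight m).measurableEmbedding
  have hpre : (fun x : ℝ => x + m) ⁻¹' Set.Ioi m = Set.Ioi 0 := by ext x; simp
  have hb : ∀ (c : ℝ) (g : ℝ → ℝ) (S : Set ℝ), S ⊆ Set.Ici c → MeasurableSet S →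
      IntegrableOn g S → IntegrableOn (fun r => min (r - c) M * g r) S := by
    intro c g S hS hSm hg
    refine Integrable.bdd_mul (c := M) hg (by fun_prop) ?_
    refine (ae_restrict_iff' hSm).2 (Filter.Eventually.of_forall fun r hr => ?_)
    have := hS hr
    simp only [Set.mem_Ici] at this
    rw [Real.norm_eq_abs, abs_of_nonneg (le_min (by linarith) hM.le)]
    exact min_le_right _ _
  have hfm : IntegrableOn f (Set.Ioi m) := hfi.mono_set (Set.Ioi_subset_Ioi hm.le)
  have hfc : IntegrableOn f (Set.Ioc 0 m) := hfi.mono_set Set.Ioc_subset_Ioi_self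
  have hshift : IntegrableOn (fun r => f (r + m)) (Set.Ioi 0) := by
    have := (hmp.integrableOn_comp_preimage hme (f := f) (s := Set.Ioi m)).2 hfm
    rwa [hpre] at this
  have hs1 : ∫ r in Set.Ioi (0:ℝ), f (r + m) = 1 / 2 := by
    have := hmp.setIntegral_preimage_emb hme f (Set.Ioi m)
    rw [hpre] at this
    rw [this, h2]
  have hs2 : ∫ r in Set.Ioi (0:ℝ), min r M * f (r + m) =
      ∫ r in Set.Ioi m, min (r - m) M * f r := by
    have := hmp.setIntegral_preimage_emb hme (fun r => min (r - m) M * f r) (Set.Ioi m)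
    rw [hpre] at this
    rw [← this]; simp
  have hφ : IntegrableOn (fun r => min r M * f r) (Set.Ioi 0) := by
    simpa using hb 0 f _ Set.Ioi_subset_Ici_self measurableSet_Ioi hfi
  have hφs : IntegrableOn (fun r => min r M * f (r + m)) (Set.Ioi 0) := by
    simpa using hb 0 (fun r => f (r + m)) _ Set.Ioi_subset_Ici_self measurableSet_Ioi hshift
  have hφm := hb m f _ Set.Ioi_subset_Ici_self measurableSet_Ioi hfm
  -- a ≤ M
  have haM : a ≤ M := by
    calc a ≤ ∫ r in Set.Ioi (0:ℝ), M * f r := by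
          refine setIntegral_mono_on hφ (hfi.const_mul M) measurableSet_Ioi fun r hr => ?_
          exact mul_le_mul_of_nonneg_right (min_le_right _ _) (hpos r hr).le
      _ = M := by rw [integral_const_mul, h1, mul_one]
  -- first inequality
  have hA : a ≤ m + ∫ r in Set.Ioi m, min (r - m) M * f r := by
    have hsplit := setIntegral_union (f := fun r => min r M * f r) (μ := volume)
      (Set.Ioc_disjoint_Ioi (le_refl m) (a := (0:ℝ)))
      measurableSet_Ioi (hφ.mono_set Set.Ioc_subset_Ioi_self)
      (hφ.mono_set (Set.Ioi_subset_Ioi hm.le))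
    rw [Set.Ioc_union_Ioi_eq_Ioi hm.le, ← ha] at hsplit
    have i1 : ∫ r in Set.Ioc 0 m, min r M * f r ≤ ∫ r in Set.Ioc 0 m, m * f r := by
      refine setIntegral_mono_on (hφ.mono_set Set.Ioc_subset_Ioi_self) (hfc.const_mul m)
        measurableSet_Ioc fun r hr => ?_
      exact mul_le_mul_of_nonneg_right ((min_le_left _ _).trans hr.2) (hpos r hr.1).le
    have i2 : ∫ r in Set.Ioi m, min r M * f r ≤
        ∫ r in Set.Ioi m, (m * f r + min (r - m) M * f r) := by
      refine setIntegral_mono_on (hφ.mono_set (Set.Ioi_subset_Ioi hm.le))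
        ((hfm.const_mul m).add hφm) measurableSet_Ioi fun r hr => ?_
      rw [← add_mul]
      refine mul_le_mul_of_nonneg_right ?_ (hpos r (hm.trans hr)).le
      rcases le_total (r - m) M with h | h
      · rw [min_eq_left h]; linarith [min_le_left r M]
      · rw [min_eq_right h]; linarith [min_le_right r M]
    rw [integral_add (hfm.const_mul m) hφm, integral_const_mul, h2] at i2
    rw [integral_const_mul, h3] at i1
    linarith
  -- Chebyshev
  have hB : ∫ r in Set.Ioi (0:ℝ), (min r M - a) * (f (r + m) * f a) ≤
      ∫ r in Set.Ioi (0:ℝ), (min r M - a) * (f (a + m) * f r) := by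
    refine setIntegral_mono_on ?_ ?_ measurableSet_Ioi fun r hr => ?_
    · have := (hφs.sub (hshift.const_mul a)).mul_const (f a)
      refine this.congr (Filter.Eventually.of_forall fun r => ?_)
      simp only [Pi.sub_apply]; ring
    · have := (hφ.sub (hfi.const_mul a)).mul_const (f (a + m))
      refine this.congr (Filter.Eventually.of_forall fun r => ?_)
      simp only [Pi.sub_apply]; ring
    · rcases le_total r a with h | h
      · have h' := hq r a hr h
        rw [min_eq_left (h.trans haM)]
        nlinarith
      · have h' := hq a r ha0 h
        have : 0 ≤ min r M - a := sub_nonneg.2 (le_min h haM)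
        nlinarith
  have e1 : ∫ r in Set.Ioi (0:ℝ), (min r M - a) * (f (r + m) * f a) =
      ((∫ r in Set.Ioi (0:ℝ), min r M * f (r + m)) - a * (1 / 2)) * f a := by
    rw [← hs1, ← integral_const_mul, ← integral_sub hφs (hshift.const_mul a), ← integral_mul_const]
    congr 1; ext r; ring
  have e2 : ∫ r in Set.Ioi (0:ℝ), (min r M - a) * (f (a + m) * f r) = 0 := by
    have : ∫ r in Set.Ioi (0:ℝ), (min r M - a) * (f (a + m) * f r) =
        (a - a * 1) * f (a + m) := by
      nth_rewrite 2 [ha]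
      rw [← h1, ← integral_const_mul, ← integral_sub hφ (hfi.const_mul a), ← integral_mul_const]
      congr 1; ext r; ring
    rw [this]; ring
  rw [e1, e2] at hB
  have := nonpos_of_mul_nonpos_left hB (hpos a ha0)
  rw [hs2] at this
  linarith

lemma aux_logconc (g : ℝ → ℝ) (hgconv : ConvexOn ℝ (Set.Ici 0) g) (n : ℕ) (c : ℝ) (hc : 0 < c)
    (m : ℝ) (hm : 0 < m) (r s : ℝ) (hr : 0 < r) (hrs : r ≤ s) :
    (c * (r ^ n * Real.exp (-g r))) * (c * ((s + m) ^ n * Real.exp (-g (s + m)))) ≤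
    (c * ((r + m) ^ n * Real.exp (-g (r + m)))) * (c * (s ^ n * Real.exp (-g s))) := by
  have hD : 0 < s - r + m := by linarith
  have k1 := hgconv.2 (show r ∈ Set.Ici (0:ℝ) from hr.le)
    (show s + m ∈ Set.Ici (0:ℝ) by simp only [Set.mem_Ici]; linarith)
    (show 0 ≤ (s - r) / (s - r + m) by apply div_nonneg <;> linarith)
    (show 0 ≤ m / (s - r + m) by positivity) (by field_simp)
  have k2 := hgconv.2 (show r ∈ Set.Ici (0:ℝ) from hr.le)
    (show s + m ∈ Set.Ici (0:ℝ) by simp only [Set.mem_Ici]; linarith)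
    (show 0 ≤ m / (s - r + m) by positivity)
    (show 0 ≤ (s - r) / (s - r + m) by apply div_nonneg <;> linarith) (by field_simp; ring)
  simp only [smul_eq_mul] at k1 k2
  have p1 : (s - r) / (s - r + m) * r + m / (s - r + m) * (s + m) = r + m := by
    field_simp; ring
  have p2 : m / (s - r + m) * r + (s - r) / (s - r + m) * (s + m) = s := by
    field_simp; ring
  rw [p1] at k1
  rw [p2] at k2
  have hsum : (s - r) / (s - r + m) + m / (s - r + m) = 1 := by field_simp
  have hg : g (r + m) + g s ≤ g r + g (s + m) := by
    have : g (r + m) + g s ≤ ((s - r) / (s - r + m) + m / (s - r + m)) * (g r + g (s + m)) := by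
      linarith
    rwa [hsum, one_mul] at this
  have hpw : r ^ n * (s + m) ^ n ≤ (r + m) ^ n * s ^ n := by
    rw [← mul_pow, ← mul_pow]
    apply pow_le_pow_left₀
    · apply mul_nonneg <;> linarith
    · nlinarith
  have hex : Real.exp (-g r) * Real.exp (-g (s + m)) ≤ Real.exp (-g (r + m)) * Real.exp (-g s) := by
    rw [← Real.exp_add, ← Real.exp_add]
    apply Real.exp_le_exp.2; linarith
  calc _ = c * c * ((r ^ n * (s + m) ^ n) * (Real.exp (-g r) * Real.exp (-g (s + m)))) := by ring
    _ ≤ c * c * (((r + m) ^ n * s ^ n) * (Real.exp (-g (r + m)) * Real.exp (-g s))) := by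
      have : 0 ≤ (r + m) ^ n * s ^ n := by
        have : 0 < s := by linarith
        positivity
      gcongr
    _ = _ := by ring

lemma aux_coupling (d : ℕ) (ρ : Measure (EuclideanSpace ℝ (Fin d))) [IsProbabilityMeasure ρ]
    (hneg : ∀ h : EuclideanSpace ℝ (Fin d) → ℝ≥0∞, Measurable h →
      ∫⁻ y, h (-y) ∂ρ = ∫⁻ y, h y ∂ρ)
    (m : ℝ) (hm : 0 < m) (hA : ρ {x | ‖x‖ ≤ m} = 1 / 2) (hB : ρ {x | m < ‖x‖} = 1 / 2) :
    (⨅ (lam : Measure (EuclideanSpace ℝ (Fin d) × EuclideanSpace ℝ (Fin d)))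
          (_ : IsProbabilityMeasure lam ∧ lam.map Prod.fst = ρ ∧ lam.map Prod.snd = ρ),
          essSup (fun p => (edist p.1 p.2)⁻¹) lam) ≤ (ENNReal.ofReal m)⁻¹ := by
  set E := EuclideanSpace ℝ (Fin d) with hE
  let w : ℝ → ℝ≥0∞ := fun t => if t < 0 then 2 else if t = 0 then 1 else 0
  have hwm : Measurable w := by
    refine Measurable.ite measurableSet_Iio measurable_const ?_
    exact Measurable.ite (measurableSet_singleton 0) measurable_const measurable_const
  have hww : ∀ t, w t + w (-t) = 2 := by
    intro t
    rcases lt_trichotomy t 0 with h | h | h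
    · have : ¬ (-t < 0) := by linarith
      have h3 : -t ≠ 0 := by linarith
      simp [w, h, this, h.ne]
    · simp [w, h]; norm_num
    · have h2 : ¬ (t < 0) := by linarith
      simp [w, h, h2, h.ne']
  let F : E × E → ℝ≥0∞ := fun p => 2 * (({x : E | ‖x‖ ≤ m}.indicator 1 p.1 *
      {x : E | m < ‖x‖}.indicator 1 p.2 + {x : E | m < ‖x‖}.indicator 1 p.1 *
      {x : E | ‖x‖ ≤ m}.indicator 1 p.2) * w (inner ℝ p.1 p.2))
  have mA : MeasurableSet {x : E | ‖x‖ ≤ m} := measurableSet_le measurable_norm measurable_const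
  have mB : MeasurableSet {x : E | m < ‖x‖} := measurableSet_lt measurable_const measurable_norm
  have iA : Measurable ({x : E | ‖x‖ ≤ m}.indicator (1 : E → ℝ≥0∞)) := measurable_one.indicator mA
  have iB : Measurable ({x : E | m < ‖x‖}.indicator (1 : E → ℝ≥0∞)) := measurable_one.indicator mB
  have hin : Measurable (fun p : E × E => inner ℝ p.1 p.2) :=
    (continuous_fst.inner continuous_snd).measurable
  have hFm : Measurable F := by
    refine measurable_const.mul (Measurable.mul ?_ (hwm.comp hin))
    exact ((iA.comp measurable_fst).mul (iB.comp measurable_snd)).add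
      ((iB.comp measurable_fst).mul (iA.comp measurable_snd))
  have hFs : ∀ x y, F (x, y) = F (y, x) := by
    intro x y
    simp only [F]
    rw [real_inner_comm y x]
    ring
  have hhalf : ∀ (x : E) (S : Set E), MeasurableSet S → (∀ y, -y ∈ S ↔ y ∈ S) → ρ S = 1 / 2 →
      ∫⁻ y, S.indicator 1 y * w (inner ℝ x y) ∂ρ = 1 / 2 := by
    intro x S hS hSn hρS
    have hmx : Measurable fun y : E => w (inner ℝ x y) :=
      hwm.comp (continuous_const.inner continuous_id).measurable
    have hmm : Measurable fun y : E => S.indicator (1 : E → ℝ≥0∞) y * w (inner ℝ x y) :=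
      (measurable_one.indicator hS).mul hmx
    have e := hneg _ hmm
    have hind : ∀ y, S.indicator (1 : E → ℝ≥0∞) (-y) = S.indicator 1 y := by
      intro y
      by_cases h : y ∈ S
      · rw [Set.indicator_of_mem h, Set.indicator_of_mem ((hSn y).2 h)]; rfl
      · rw [Set.indicator_of_notMem h, Set.indicator_of_notMem (fun h' => h ((hSn y).1 h'))]
    have e2 : (∫⁻ y, S.indicator 1 y * w (inner ℝ x y) ∂ρ) +
        (∫⁻ y, S.indicator 1 (-y) * w (inner ℝ x (-y)) ∂ρ) = 1 := by
      rw [← lintegral_add_left hmm]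
      have : ∀ y, S.indicator (1 : E → ℝ≥0∞) y * w (inner ℝ x y) +
          S.indicator 1 (-y) * w (inner ℝ x (-y)) = 2 * S.indicator 1 y := by
        intro y
        rw [hind, inner_neg_right, ← mul_add, hww, mul_comm]
      simp_rw [this]
      rw [lintegral_const_mul _ (measurable_one.indicator hS), lintegral_indicator_one hS, hρS]
      simp [ENNReal.mul_inv_cancel]
    rw [e, ← two_mul] at e2
    rw [ENNReal.eq_div_iff (by norm_num) (by norm_num)]
    exact e2
  have hAn : ∀ y : E, -y ∈ {x : E | ‖x‖ ≤ m} ↔ y ∈ {x : E | ‖x‖ ≤ m} := by intro y; simp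
  have hBn : ∀ y : E, -y ∈ {x : E | m < ‖x‖} ↔ y ∈ {x : E | m < ‖x‖} := by intro y; simp
  have hmarg : ∀ x, ∫⁻ y, F (x, y) ∂ρ = 1 := by
    intro x
    have h21 : (2:ℝ≥0∞) * (1 / 2) = 1 := by simp [ENNReal.mul_inv_cancel]
    by_cases hx : ‖x‖ ≤ m
    · have hx' : ¬ m < ‖x‖ := not_lt.2 hx
      have : ∀ y, F (x, y) = 2 * ({x : E | m < ‖x‖}.indicator 1 y * w (inner ℝ x y)) := by
        intro y; simp [F, hx, hx']
      simp_rw [this]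
      rw [lintegral_const_mul' _ _ (by norm_num), hhalf x _ mB hBn hB, h21]
    · have hx' : m < ‖x‖ := not_le.1 hx
      have : ∀ y, F (x, y) = 2 * ({x : E | ‖x‖ ≤ m}.indicator 1 y * w (inner ℝ x y)) := by
        intro y; simp [F, hx, hx']
      simp_rw [this]
      rw [lintegral_const_mul' _ _ (by norm_num), hhalf x _ mA hAn hA, h21]
  let lam := (ρ.prod ρ).withDensity F
  have h1 : lam.map Prod.fst = ρ := by
    ext S hS
    rw [Measure.map_apply measurable_fst hS, withDensity_apply _ (measurable_fst hS),
      ← lintegral_indicator (measurable_fst hS),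
      lintegral_prod _ (hFm.indicator (measurable_fst hS)).aemeasurable]
    have : ∀ x, ∫⁻ y, (Prod.fst ⁻¹' S).indicator F (x, y) ∂ρ = S.indicator 1 x := by
      intro x
      by_cases h : x ∈ S
      · rw [Set.indicator_of_mem h, Pi.one_apply, ← hmarg x]
        congr 1; ext y
        exact Set.indicator_of_mem (by simpa using h) F
      · rw [Set.indicator_of_notMem h]
        rw [← lintegral_zero (μ := ρ)]
        congr 1; ext y
        exact Set.indicator_of_notMem (by simpa using h) F
    exact (lintegral_congr this).trans (lintegral_indicator_one hS)
  have h2 : lam.map Prod.snd = ρ := by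
    ext S hS
    rw [Measure.map_apply measurable_snd hS, withDensity_apply _ (measurable_snd hS),
      ← lintegral_indicator (measurable_snd hS),
      lintegral_prod_symm _ (hFm.indicator (measurable_snd hS)).aemeasurable]
    have : ∀ x, ∫⁻ y, (Prod.snd ⁻¹' S).indicator F (y, x) ∂ρ = S.indicator 1 x := by
      intro x
      by_cases h : x ∈ S
      · rw [Set.indicator_of_mem h, Pi.one_apply, ← hmarg x]
        congr 1; ext y
        rw [hFs x y]
        exact Set.indicator_of_mem (by simpa using h) F
      · rw [Set.indicator_of_notMem h]
        rw [← lintegral_zero (μ := ρ)]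
        congr 1; ext y
        exact Set.indicator_of_notMem (by simpa using h) F
    exact (lintegral_congr this).trans (lintegral_indicator_one hS)
  have hp : IsProbabilityMeasure lam := by
    constructor
    have := congrArg (fun μ => μ Set.univ) h1
    simpa [Measure.map_apply measurable_fst] using this
  refine iInf₂_le_of_le lam ⟨hp, h1, h2⟩ ?_
  refine essSup_le_of_ae_le _ ?_
  refine (ae_withDensity_iff hFm).2 (Filter.Eventually.of_forall fun p hpF => ?_)
  rw [ENNReal.inv_le_inv, edist_dist, dist_eq_norm]
  refine ENNReal.ofReal_le_ofReal ?_
  have hin0 : inner ℝ p.1 p.2 ≤ 0 := by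
    by_contra hcon
    push Not at hcon
    apply hpF
    simp [F, w, hcon.ne', not_lt.2 hcon.le]
  have hn := norm_sub_sq_real p.1 p.2
  have hor : m ≤ ‖p.1‖ ∨ m ≤ ‖p.2‖ := by
    by_contra hcon
    push Not at hcon
    apply hpF
    simp [F, not_lt.2 hcon.1.le, not_lt.2 hcon.2.le]
  refine (sq_le_sq₀ hm.le (norm_nonneg _)).1 ?_
  rcases hor with h | h <;> nlinarith [sq_nonneg ‖p.1‖, sq_nonneg ‖p.2‖]

lemma aux_lower (d : ℕ) (ρ : Measure (EuclideanSpace ℝ (Fin d)))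
    (lam : Measure (EuclideanSpace ℝ (Fin d) × EuclideanSpace ℝ (Fin d))) [IsProbabilityMeasure lam]
    (h1 : lam.map Prod.fst = ρ) (h2 : lam.map Prod.snd = ρ)
    (m : ℝ) (hm : 0 < m) (hmean : ∫⁻ x, ‖x‖ₑ ∂ρ ≤ ENNReal.ofReal (2 * m)) :
    (ENNReal.ofReal m)⁻¹ / 4 ≤ ∫⁻ p, (edist p.1 p.2)⁻¹ ∂lam := by
  set s : ℝ := 4 * m with hs
  have hs0 : 0 < s := by positivity
  have hE : ∫⁻ p, edist p.1 p.2 ∂lam ≤ ENNReal.ofReal s := by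
    calc ∫⁻ p, edist p.1 p.2 ∂lam ≤ ∫⁻ p, (‖p.1‖ₑ + ‖p.2‖ₑ) ∂lam := by
          refine lintegral_mono fun p => ?_
          rw [edist_eq_enorm_sub]; exact enorm_sub_le
      _ = (∫⁻ p, ‖p.1‖ₑ ∂lam) + ∫⁻ p, ‖p.2‖ₑ ∂lam := lintegral_add_left (by fun_prop) _
      _ = (∫⁻ x, ‖x‖ₑ ∂ρ) + ∫⁻ x, ‖x‖ₑ ∂ρ := by
          congr 1
          · rw [← h1, lintegral_map (by fun_prop) measurable_fst]
          · rw [← h2, lintegral_map (by fun_prop) measurable_snd]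
      _ ≤ ENNReal.ofReal (2 * m) + ENNReal.ofReal (2 * m) := add_le_add hmean hmean
      _ = ENNReal.ofReal s := by
          rw [← ENNReal.ofReal_add (by positivity) (by positivity)]; congr 1; rw [hs]; ring
  have hpt : ∀ p : EuclideanSpace ℝ (Fin d) × EuclideanSpace ℝ (Fin d),
      ENNReal.ofReal (2 / s) ≤ (edist p.1 p.2)⁻¹ + ENNReal.ofReal (1 / s ^ 2) * edist p.1 p.2 := by
    intro p
    rw [edist_dist]
    rcases (dist_nonneg (x := p.1) (y := p.2)).lt_or_eq with h | h
    · rw [← ENNReal.ofReal_inv_of_pos h, ← ENNReal.ofReal_mul (by positivity),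
        ← ENNReal.ofReal_add (by positivity) (by positivity)]
      refine ENNReal.ofReal_le_ofReal ?_
      set t := dist p.1 p.2
      have : t⁻¹ + 1 / s ^ 2 * t - 2 / s = (s - t) ^ 2 / (t * s ^ 2) := by
        field_simp; ring
      have h3 : 0 ≤ (s - t) ^ 2 / (t * s ^ 2) := by positivity
      linarith
    · rw [← h]; simp
  have hint : ENNReal.ofReal (2 / s) ≤ (∫⁻ p, (edist p.1 p.2)⁻¹ ∂lam) + ENNReal.ofReal (1 / s) := by
    calc ENNReal.ofReal (2 / s) = ∫⁻ p, ENNReal.ofReal (2 / s) ∂lam := by simp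
      _ ≤ ∫⁻ p, ((edist p.1 p.2)⁻¹ + ENNReal.ofReal (1 / s ^ 2) * edist p.1 p.2) ∂lam :=
        lintegral_mono hpt
      _ = (∫⁻ p, (edist p.1 p.2)⁻¹ ∂lam) + ENNReal.ofReal (1 / s ^ 2) * ∫⁻ p, edist p.1 p.2 ∂lam := by
        rw [lintegral_add_left (by fun_prop), lintegral_const_mul _ (by fun_prop)]
      _ ≤ (∫⁻ p, (edist p.1 p.2)⁻¹ ∂lam) + ENNReal.ofReal (1 / s ^ 2) * ENNReal.ofReal s := by
        gcongr
      _ = _ := by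
        rw [← ENNReal.ofReal_mul (by positivity)]
        congr 2; field_simp
  have hsplit : ENNReal.ofReal (2 / s) = ENNReal.ofReal (1 / s) + ENNReal.ofReal (1 / s) := by
    rw [← ENNReal.ofReal_add (by positivity) (by positivity)]; congr 1; ring
  rw [hsplit] at hint
  have := ENNReal.le_of_add_le_add_right ENNReal.ofReal_ne_top hint
  refine le_trans (le_of_eq ?_) this
  rw [← ENNReal.ofReal_inv_of_pos hm, show (4:ℝ≥0∞) = ENNReal.ofReal 4 by simp,
    ← ENNReal.ofReal_div_of_pos (by norm_num)]
  congr 1; rw [hs]; field_simp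

lemma aux_polar (d : ℕ) (hd : d ≠ 0)
    (ρ : Measure (EuclideanSpace ℝ (Fin d)))
    (K : ℝ) (hK : 0 < K)
    (g : ℝ → ℝ)
    (hgmono : MonotoneOn g (Set.Ici 0))
    (hρ : ρ = volume.withDensity (fun x => ENNReal.ofReal (K * Real.exp (-g ‖x‖)))) :
    ∃ c : ℝ, 0 < c ∧ ∀ ψ : ℝ → ℝ, ∫ x, ψ ‖x‖ ∂ρ =
      ∫ r in Set.Ioi (0:ℝ), ψ r * (c * (r ^ (d - 1) * Real.exp (-g r))) := by
  have : Nonempty (Fin d) := ⟨⟨0, Nat.pos_of_ne_zero hd⟩⟩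
  have hmeas : Measurable fun x : EuclideanSpace ℝ (Fin d) =>
      ENNReal.ofReal (K * Real.exp (-g ‖x‖)) := by
    have hm : Monotone fun t => g (max 0 t) := fun a b hab =>
      hgmono (Set.mem_Ici.2 (le_max_left 0 a)) (Set.mem_Ici.2 (le_max_left 0 b))
        (max_le_max le_rfl hab)
    have h2 : Measurable fun x : EuclideanSpace ℝ (Fin d) => g ‖x‖ := by
      have := hm.measurable.comp (measurable_norm (α := EuclideanSpace ℝ (Fin d)))
      convert this using 1
      ext x; simp
    exact (((h2.neg).exp).const_mul K).ennreal_ofReal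
  refine ⟨(d : ℝ) * (volume : Measure (EuclideanSpace ℝ (Fin d))).real (ball 0 1) * K, ?_, ?_⟩
  · have hb : 0 < (volume : Measure (EuclideanSpace ℝ (Fin d))).real (ball 0 1) :=
      ENNReal.toReal_pos (measure_ball_pos _ _ one_pos).ne' measure_ball_lt_top.ne
    have : 0 < (d:ℝ) := by exact_mod_cast Nat.pos_of_ne_zero hd
    positivity
  · intro ψ
    rw [hρ, integral_withDensity_eq_integral_toReal_smul hmeas (by simp)]
    have := integral_fun_norm_addHaar (volume : Measure (EuclideanSpace ℝ (Fin d)))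
      (fun t => (ENNReal.ofReal (K * Real.exp (-g t))).toReal • ψ t)
    rw [this, finrank_euclideanSpace_fin]
    simp only [nsmul_eq_mul, smul_eq_mul]
    rw [← integral_const_mul, ← integral_const_mul]
    congr 1; ext r
    rw [ENNReal.toReal_ofReal (by positivity)]
    ring

theorem stmt15 (d : ℕ)
    (ρ : Measure (EuclideanSpace ℝ (Fin d))) [IsProbabilityMeasure ρ]
    (K : ℝ) (hK : 0 < K)
    (g : ℝ → ℝ)
    (hg0 : ∀ t : ℝ, 0 ≤ t → 0 ≤ g t)
    (hgmono : MonotoneOn g (Set.Ici 0))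
    (hgconv : ConvexOn ℝ (Set.Ici 0) g)
    (hρ : ρ = volume.withDensity (fun x => ENNReal.ofReal (K * Real.exp (-g ‖x‖)))) :
    (⨅ (lam : Measure (EuclideanSpace ℝ (Fin d) × EuclideanSpace ℝ (Fin d)))
        (_ : IsProbabilityMeasure lam ∧ lam.map Prod.fst = ρ ∧ lam.map Prod.snd = ρ),
        ∫⁻ p, (edist p.1 p.2)⁻¹ ∂lam)
      ≥ (⨅ (lam : Measure (EuclideanSpace ℝ (Fin d) × EuclideanSpace ℝ (Fin d)))
          (_ : IsProbabilityMeasure lam ∧ lam.map Prod.fst = ρ ∧ lam.map Prod.snd = ρ),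
          essSup (fun p => (edist p.1 p.2)⁻¹) lam) / 4 := by
  rcases Nat.eq_zero_or_pos d with hd | hd
  · subst hd
    refine le_iInf₂ fun lam hlam => ?_
    have := hlam.1
    have h : ∀ p : EuclideanSpace ℝ (Fin 0) × EuclideanSpace ℝ (Fin 0),
        (edist p.1 p.2)⁻¹ = ⊤ := by
      intro p
      rw [Subsingleton.elim p.1 p.2]; simp
    simp_rw [h]
    simp
  obtain ⟨c, hc, hpol⟩ := aux_polar d hd.ne' ρ K hK g hgmono hρ
  set f : ℝ → ℝ := fun r => c * (r ^ (d - 1) * Real.exp (-g r)) with hf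
  have h1 : ∫ r in Set.Ioi (0:ℝ), f r = 1 := by
    have := hpol (fun _ => 1)
    simpa using this.symm
  have hfi : IntegrableOn f (Set.Ioi 0) := by
    by_contra hcon
    rw [integral_undef hcon] at h1
    norm_num at h1
  obtain ⟨m, hm, h2, h3⟩ := aux_median f hfi h1
  have hmean := aux_mean f hfi h1 (fun r hr => by simp only [hf]; positivity) m hm
    (fun r s hr hrs => aux_logconc g hgconv (d - 1) c hc m hm r s hr hrs) h2 h3
  have mB : MeasurableSet {x : EuclideanSpace ℝ (Fin d) | m < ‖x‖} :=
    measurableSet_lt measurable_const measurable_norm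
  have hBr : ρ.real {x | m < ‖x‖} = 1 / 2 := by
    have e := hpol ((Set.Ioi m).indicator 1)
    have e1 : ∫ x, (Set.Ioi m).indicator (1 : ℝ → ℝ) ‖x‖ ∂ρ = ρ.real {x | m < ‖x‖} := by
      rw [← integral_indicator_one mB]
      rfl
    have e2 : ∫ r in Set.Ioi (0:ℝ), (Set.Ioi m).indicator (1 : ℝ → ℝ) r * f r = 1 / 2 := by
      have : ∀ r, (Set.Ioi m).indicator (1 : ℝ → ℝ) r * f r = (Set.Ioi m).indicator f r := by
        intro r
        by_cases h : r ∈ Set.Ioi m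
        · simp only [Set.indicator_of_mem h]; simp
        · simp only [Set.indicator_of_notMem h]; simp
      simp_rw [this]
      rw [setIntegral_indicator measurableSet_Ioi, Set.inter_eq_right.2 (Set.Ioi_subset_Ioi hm.le),
        h2]
    rw [← e1, e]
    exact e2
  have hB : ρ {x | m < ‖x‖} = 1 / 2 := by
    rw [← ofReal_measureReal, hBr, ENNReal.ofReal_div_of_pos (by norm_num)]
    simp
  have hA : ρ {x | ‖x‖ ≤ m} = 1 / 2 := by
    have : {x : EuclideanSpace ℝ (Fin d) | ‖x‖ ≤ m} = {x | m < ‖x‖}ᶜ := by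
      ext x; simp
    rw [this, prob_compl_eq_one_sub mB, hB]
    simp
  have hneg : ∀ h : EuclideanSpace ℝ (Fin d) → ℝ≥0∞, Measurable h →
      ∫⁻ y, h (-y) ∂ρ = ∫⁻ y, h y ∂ρ := by
    intro h hh
    have hnegm : ρ.map (fun y => -y) = ρ := by
      ext S hS
      have hS' : MeasurableSet ((fun y : EuclideanSpace ℝ (Fin d) => -y) ⁻¹' S) := measurable_neg hS
      rw [Measure.map_apply measurable_neg hS, hρ, withDensity_apply _ hS, withDensity_apply _ hS']
      have hmp := Measure.measurePreserving_neg (volume : Measure (EuclideanSpace ℝ (Fin d)))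
      have := hmp.setLIntegral_comp_preimage_emb
        (Homeomorph.neg (EuclideanSpace ℝ (Fin d))).measurableEmbedding
        (fun x => ENNReal.ofReal (K * Real.exp (-g ‖x‖))) S
      simp only [norm_neg] at this
      exact this
    conv_rhs => rw [← hnegm]
    rw [lintegral_map hh measurable_neg]
  have hmean' : ∫⁻ x, ‖x‖ₑ ∂ρ ≤ ENNReal.ofReal (2 * m) := by
    have ht : Filter.Tendsto
        (fun n : ℕ => ∫⁻ x : EuclideanSpace ℝ (Fin d), ENNReal.ofReal (min ‖x‖ ((n:ℝ) + 1)) ∂ρ)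
        Filter.atTop (nhds (∫⁻ x, ‖x‖ₑ ∂ρ)) := by
      refine lintegral_tendsto_of_tendsto_of_monotone (fun n => by fun_prop) ?_ ?_
      · refine Filter.Eventually.of_forall fun x i j hij => ?_
        refine ENNReal.ofReal_le_ofReal (min_le_min le_rfl ?_)
        have : (i:ℝ) ≤ j := by exact_mod_cast hij
        linarith
      · refine Filter.Eventually.of_forall fun x => ?_
        refine tendsto_const_nhds.congr' ?_
        obtain ⟨N, hN⟩ := exists_nat_ge ‖x‖
        filter_upwards [Filter.eventually_ge_atTop N] with n hn
        have : (N:ℝ) ≤ n := by exact_mod_cast hn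
        rw [min_eq_left (by linarith), ofReal_norm]
    refine le_of_tendsto' ht fun n => ?_
    have hn : (0:ℝ) < n + 1 := by positivity
    have hnn : ∀ x : EuclideanSpace ℝ (Fin d), 0 ≤ min ‖x‖ ((n:ℝ) + 1) :=
      fun x => le_min (norm_nonneg _) hn.le
    rw [← ofReal_integral_eq_lintegral_ofReal _ (Filter.Eventually.of_forall hnn)]
    · refine ENNReal.ofReal_le_ofReal ?_
      have := hpol (fun r => min r ((n:ℝ) + 1))
      exact this.le.trans (hmean _ hn)
    · refine Integrable.of_bound (by fun_prop) ((n:ℝ) + 1) (Filter.Eventually.of_forall fun x => ?_)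
      rw [Real.norm_eq_abs, abs_of_nonneg (hnn x)]
      exact min_le_right _ _
  have hcoup := aux_coupling d ρ hneg m hm hA hB
  refine le_iInf₂ fun lam hlam => ?_
  have := hlam.1
  exact (ENNReal.div_le_div_right hcoup 4).trans
    (aux_lower d ρ lam hlam.2.1 hlam.2.2 m hm hmean')
end
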